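/- Let H be a separable infinite-dimensional complex Hilbert space, T1 and T2 bounded operators on H, and λ ≥ 1. If T2 lies in the norm closure of the set {S T1 S⁻¹ : S is an invertible bounded operator on H with ‖S‖·‖S⁻¹‖ ≤ λ}, then there exists a sequence (S_n) of invertible bounded operators on H with ‖S_n‖·‖S_n⁻¹‖ ≤ λ for all n, such that ‖T2 − S_n T1 S_n⁻¹‖ → 0 as n → ∞ and T2 − S_n T1 S_n⁻¹ is a compact operator for every n. -/

import Mathlib

section helpers
open Filter Topology InnerProductSpace ContinuousLinearMap
set_option linter.unusedSectionVars false


section VoicA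
variable {E F G H : Type*} [NormedAddCommGroup E] [InnerProductSpace ℂ E] [CompleteSpace E]
  [NormedAddCommGroup F] [InnerProductSpace ℂ F] [CompleteSpace F]
  [NormedAddCommGroup G] [InnerProductSpace ℂ G] [CompleteSpace G]
  [NormedAddCommGroup H] [InnerProductSpace ℂ H] [CompleteSpace H]

/-- finite rank operators with range in `D` -/
noncomputable def FRD (E : Type*) {F : Type*} [NormedAddCommGroup E] [InnerProductSpace ℂ E]
    [NormedAddCommGroup F] [InnerProductSpace ℂ F] (D : Submodule ℂ F) :
    Submodule ℂ (E →L[ℂ] F) :=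
  Submodule.span ℂ {A | ∃ d ∈ D, ∃ u : E, A = rankOne ℂ d u}

/-- norm closure of finite rank operators -/
noncomputable def Cpt (E F : Type*) [NormedAddCommGroup E] [InnerProductSpace ℂ E]
    [NormedAddCommGroup F] [InnerProductSpace ℂ F] :
    Submodule ℂ (E →L[ℂ] F) :=
  (FRD E (⊤ : Submodule ℂ F)).topologicalClosure

lemma FRD_comp_right {D : Submodule ℂ F} {A : E →L[ℂ] F} (hA : A ∈ FRD E D) (B : G →L[ℂ] E) :
    A ∘L B ∈ FRD G D := by
  induction hA using Submodule.span_induction with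
  | mem x hx =>
    obtain ⟨d, hd, u, rfl⟩ := hx
    rw [InnerProductSpace.rankOne_comp]
    exact Submodule.subset_span ⟨d, hd, _, rfl⟩
  | zero => simp
  | add x y _ _ hx hy => rw [ContinuousLinearMap.add_comp]; exact add_mem hx hy
  | smul a x _ hx => rw [ContinuousLinearMap.smul_comp]; exact Submodule.smul_mem _ _ hx

lemma FRD_comp_left {D : Submodule ℂ F} {D' : Submodule ℂ G} {A : E →L[ℂ] F} (hA : A ∈ FRD E D)
    (B : F →L[ℂ] G) (hB : ∀ d ∈ D, B d ∈ D') :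
    B ∘L A ∈ FRD E D' := by
  induction hA using Submodule.span_induction with
  | mem x hx =>
    obtain ⟨d, hd, u, rfl⟩ := hx
    rw [InnerProductSpace.comp_rankOne]
    exact Submodule.subset_span ⟨_, hB d hd, _, rfl⟩
  | zero => simp
  | add x y _ _ hx hy => rw [ContinuousLinearMap.comp_add]; exact add_mem hx hy
  | smul a x _ hx => rw [ContinuousLinearMap.comp_smul]; exact Submodule.smul_mem _ _ hx

lemma FRD_adjoint {A : E →L[ℂ] F} (hA : A ∈ FRD E (⊤ : Submodule ℂ F)) :
    adjoint A ∈ FRD F (⊤ : Submodule ℂ E) := by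
  induction hA using Submodule.span_induction with
  | mem x hx =>
    obtain ⟨d, hd, u, rfl⟩ := hx
    rw [InnerProductSpace.adjoint_rankOne]
    exact Submodule.subset_span ⟨_, trivial, _, rfl⟩
  | zero => simp
  | add x y _ _ hx hy => rw [map_add]; exact add_mem hx hy
  | smul a x _ hx => rw [map_smulₛₗ]; exact Submodule.smul_mem _ _ hx

lemma FRD_le_top {D : Submodule ℂ F} {A : E →L[ℂ] F} (hA : A ∈ FRD E D) :
    A ∈ FRD E (⊤ : Submodule ℂ F) := by
  refine Submodule.span_mono ?_ hA
  rintro _ ⟨d, hd, u, rfl⟩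
  exact ⟨d, trivial, u, rfl⟩

lemma FRD_le_Cpt {D : Submodule ℂ F} {A : E →L[ℂ] F} (hA : A ∈ FRD E D) : A ∈ Cpt E F :=
  Submodule.le_topologicalClosure _ (FRD_le_top hA)

lemma Cpt_isClosed : IsClosed (Cpt E F : Set (E →L[ℂ] F)) :=
  Submodule.isClosed_topologicalClosure _

lemma Cpt_comp_right {A : E →L[ℂ] F} (hA : A ∈ Cpt E F) (B : G →L[ℂ] E) :
    A ∘L B ∈ Cpt G F := by
  have hc : Continuous (fun A : E →L[ℂ] F => A ∘L B) := by fun_prop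
  refine map_mem_closure (f := fun A : E →L[ℂ] F => A ∘L B) hc hA ?_
  intro A hA
  exact FRD_comp_right hA B

lemma Cpt_comp_left {A : E →L[ℂ] F} (hA : A ∈ Cpt E F) (B : F →L[ℂ] G) :
    B ∘L A ∈ Cpt E G := by
  have hc : Continuous (fun A : E →L[ℂ] F => B ∘L A) := by fun_prop
  refine map_mem_closure (f := _) hc hA ?_
  intro A hA
  exact FRD_comp_left hA B (fun _ _ => trivial)

lemma Cpt_adjoint {A : E →L[ℂ] F} (hA : A ∈ Cpt E F) : adjoint A ∈ Cpt F E := by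
  have hc : Continuous (fun A : E →L[ℂ] F => adjoint A) := adjoint.continuous
  refine map_mem_closure (f := _) hc hA ?_
  intro A hA
  exact FRD_adjoint hA

lemma Cpt_isCompact {A : E →L[ℂ] F} (hA : A ∈ Cpt E F) : IsCompactOperator A := by
  have h1 : (FRD E (⊤ : Submodule ℂ F)) ≤ compactOperator (RingHom.id ℂ) E F := by
    refine Submodule.span_le.2 ?_
    rintro _ ⟨d, hd, u, rfl⟩
    have : IsCompactOperator (rankOne ℂ d u) := by
      rw [InnerProductSpace.rankOne_def']
      exact (isCompactOperator_of_locallyCompactSpace_dom (innerSL ℂ u)).clm_comp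
        (ContinuousLinearMap.toSpanSingleton ℂ d)
    exact this
  have hcl : IsClosed {f : E →L[ℂ] F | IsCompactOperator f} := isClosed_setOfPred_isCompactOperator
  exact closure_minimal (fun x hx => h1 hx) hcl hA

lemma FRD_lift {D : Submodule ℂ F} {C : E →L[ℂ] F} (hC : C ∈ FRD E D) (V : F →ₗ[ℂ] H) :
    ∃ Z : E →L[ℂ] H, (∀ x, Z x = V (C x)) ∧ Z ∈ FRD E (⊤ : Submodule ℂ H) := by
  induction hC using Submodule.span_induction with
  | mem x hx =>
    obtain ⟨d, hd, u, rfl⟩ := hx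
    exact ⟨rankOne ℂ (V d) u, by simp, Submodule.subset_span ⟨_, trivial, _, rfl⟩⟩
  | zero => exact ⟨0, by simp, zero_mem _⟩
  | add x y _ _ hx hy =>
    obtain ⟨Z1, h1, h1'⟩ := hx
    obtain ⟨Z2, h2, h2'⟩ := hy
    exact ⟨Z1 + Z2, by simp [h1, h2], add_mem h1' h2'⟩
  | smul a x _ hx =>
    obtain ⟨Z1, h1, h1'⟩ := hx
    exact ⟨a • Z1, by simp [h1], Submodule.smul_mem _ _ h1'⟩

lemma FRD_tendsto {l : Filter ℕ} {D : Submodule ℂ F} {C : E →L[ℂ] F} (hC : C ∈ FRD E D)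
    (Y : ℕ → F →ₗ[ℂ] H) (hY : ∀ d ∈ D, Tendsto (fun n => Y n d) l (𝓝 0))
    (Z : ℕ → E →L[ℂ] H) (hZ : ∀ n x, Z n x = Y n (C x)) :
    Tendsto Z l (𝓝 0) := by
  induction hC using Submodule.span_induction generalizing Z with
  | mem x hx =>
    obtain ⟨d, hd, u, rfl⟩ := hx
    have : Z = fun n => rankOne ℂ (Y n d) u := by
      funext n; ext x; simp [hZ]
    rw [this, tendsto_zero_iff_norm_tendsto_zero]
    have := (tendsto_zero_iff_norm_tendsto_zero.1 (hY d hd)).mul_const ‖u‖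
    simpa using this
  | zero =>
    have : Z = fun n => 0 := by
      funext n; ext x; simp [hZ]
    rw [this]; exact tendsto_const_nhds
  | add x y hx' hy' hx hy =>
    choose Z1 h1 _ using fun n => FRD_lift hx' (Y n)
    choose Z2 h2 _ using fun n => FRD_lift hy' (Y n)
    have : Z = fun n => Z1 n + Z2 n := by
      funext n; ext x; simp [hZ, h1, h2]
    rw [this]
    simpa using (hx Z1 h1).add (hy Z2 h2)
  | smul a x hx' hx =>
    choose Z1 h1 _ using fun n => FRD_lift hx' (Y n)
    have : Z = fun n => a • Z1 n := by
      funext n; ext x; simp [hZ, h1]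
    rw [this]
    simpa using (hx Z1 h1).const_smul a

/-- the asymptotic Gram matrix -/
lemma FRD_gram {l : Filter ℕ} {D : Submodule ℂ F} {C : E →L[ℂ] F} (hC : C ∈ FRD E D)
    (V : ℕ → F →ₗ[ℂ] H)
    (hV : ∀ x ∈ D, ∀ y ∈ D, Tendsto (fun n => inner ℂ (V n x) (V n y)) l (𝓝 (inner ℂ x y)))
    (Z : ℕ → E →L[ℂ] H) (hZ : ∀ n x, Z n x = V n (C x)) :
    Tendsto (fun n => adjoint (Z n) ∘L Z n - adjoint C ∘L C) l (𝓝 0) := by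
  refine FRD_tendsto hC (fun n => (adjoint (Z n)).toLinearMap ∘ₗ V n - (adjoint C).toLinearMap)
    ?_ _ (fun n x => by simp [hZ])
  intro d hd
  have key : ∀ C ∈ FRD E D, ∀ Z : ℕ → E →L[ℂ] H, (∀ n x, Z n x = V n (C x)) →
      Tendsto (fun n => adjoint (Z n) (V n d) - adjoint C d) l (𝓝 0) := by
    intro C hC
    induction hC using Submodule.span_induction with
    | mem x hx =>
      intro Z hZ
      obtain ⟨d', hd', u, rfl⟩ := hx
      have : Z = fun n => rankOne ℂ (V n d') u := by
        funext n; ext x; simp [hZ]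
      rw [this]
      have h2 := ((hV d' hd' d hd).sub_const (inner ℂ d' d)).smul_const u
      simpa [sub_smul] using h2
    | zero =>
      intro Z hZ
      have : Z = fun n => 0 := by
        funext n; ext x; simp [hZ]
      simp [this, tendsto_const_nhds]
    | add x y hx' hy' hx hy =>
      intro Z hZ
      choose Z1 h1 _ using fun n => FRD_lift hx' (V n)
      choose Z2 h2 _ using fun n => FRD_lift hy' (V n)
      have : Z = fun n => Z1 n + Z2 n := by
        funext n; ext x; simp [hZ, h1, h2]
      rw [this]
      have := (hx Z1 h1).add (hy Z2 h2)
      simp only [add_zero] at this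
      refine this.congr fun n => ?_
      simp only [map_add, add_apply]; abel
    | smul a x hx' hx =>
      intro Z hZ
      choose Z1 h1 _ using fun n => FRD_lift hx' (V n)
      have : Z = fun n => a • Z1 n := by
        funext n; ext x; simp [hZ, h1]
      rw [this]
      have := (hx Z1 h1).const_smul (star a)
      simp only [smul_zero] at this
      refine this.congr fun n => ?_
      simp [smul_sub, map_smulₛₗ]
  simpa using key C hC Z hZ

lemma FRD_weak {l : Filter ℕ} {D : Submodule ℂ F} {C : E →L[ℂ] F} (hC : C ∈ FRD E D)
    (V : ℕ → F →ₗ[ℂ] H)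
    (hV : ∀ x ∈ D, ∀ h, Tendsto (fun n => inner ℂ h (V n x)) l (𝓝 0))
    (B : G →L[ℂ] H) (hB : B ∈ FRD G (⊤ : Submodule ℂ H))
    (Z : ℕ → E →L[ℂ] H) (hZ : ∀ n x, Z n x = V n (C x)) :
    Tendsto (fun n => adjoint B ∘L Z n) l (𝓝 0) := by
  refine FRD_tendsto hC (fun n => (adjoint B).toLinearMap ∘ₗ V n)
    ?_ _ (fun n x => by simp [hZ])
  intro d hd
  induction hB using Submodule.span_induction with
  | mem x hx =>
    obtain ⟨d', hd', u, rfl⟩ := hx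
    simpa using (hV d hd d').smul_const u
  | zero => simp [tendsto_const_nhds]
  | add x y hx' hy' hx hy => simpa using hx.add hy
  | smul a x hx' hx => simpa [map_smulₛₗ] using hx.const_smul (star a)

end VoicA


section VoicB
variable {E F G H : Type*} [NormedAddCommGroup E] [InnerProductSpace ℂ E] [CompleteSpace E]
  [NormedAddCommGroup F] [InnerProductSpace ℂ F] [CompleteSpace F]
  [NormedAddCommGroup G] [InnerProductSpace ℂ G] [CompleteSpace G]
  [NormedAddCommGroup H] [InnerProductSpace ℂ H] [CompleteSpace H]

lemma inv_add_one (Q : E →L[ℂ] E) (hQ : 0 ≤ Q) :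
    ∃ R : E →L[ℂ] E, (Q + 1) * R = 1 ∧ R * (Q + 1) = 1 ∧ ‖R‖ ≤ 1 := by
  have hu : IsUnit (Q + 1) :=
    CStarAlgebra.isUnit_of_le 1 (le_add_of_nonneg_left hQ) isStrictlyPositive_one
  obtain ⟨u, hu⟩ := hu
  refine ⟨↑u⁻¹, by rw [← hu]; simp, by rw [← hu]; simp, ?_⟩
  refine opNorm_le_bound _ zero_le_one fun x => ?_
  set y := (↑u⁻¹ : E →L[ℂ] E) x with hy
  have hx : (Q + 1) y = x := by
    rw [hy, ← hu]; exact congrArg (fun A : E →L[ℂ] E => A x) u.mul_inv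
  have h1 : 0 ≤ RCLike.re (inner ℂ (Q y) y) :=
    ((ContinuousLinearMap.nonneg_iff_isPositive Q).1 hQ).re_inner_nonneg_left y
  have h2 : ‖y‖ * ‖y‖ ≤ ‖x‖ * ‖y‖ := by
    calc ‖y‖ * ‖y‖ = RCLike.re (inner ℂ y y) := by rw [inner_self_eq_norm_mul_norm]
      _ ≤ RCLike.re (inner ℂ x y) := by
          have h3 : x = Q y + y := hx.symm
          rw [h3, inner_add_left, map_add]; linarith
      _ ≤ ‖x‖ * ‖y‖ := re_inner_le_norm x y
  rw [one_mul]
  rcases (norm_nonneg y).eq_or_lt with h | h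
  · rw [← h]; exact norm_nonneg x
  · exact le_of_mul_le_mul_right h2 h

lemma polar_fix (V : E →L[ℂ] H) (hC : adjoint V ∘L V - 1 ∈ Cpt E E)
    (hn : ‖adjoint V ∘L V - 1‖ ≤ 1 / 2) :
    ∃ V' : E →L[ℂ] H, adjoint V' ∘L V' = 1 ∧ V' - V ∈ Cpt E H ∧
      ‖V' - V‖ ≤ 2 * ‖adjoint V ∘L V - 1‖ := by
  set A := adjoint V ∘L V with hA
  have hApos : 0 ≤ A := by
    rw [ContinuousLinearMap.nonneg_iff_isPositive]
    exact ContinuousLinearMap.isPositive_adjoint_comp_self V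
  set Q := CFC.sqrt A with hQ
  have hQpos : 0 ≤ Q := CFC.sqrt_nonneg A
  have hQQ : Q * Q = A := CFC.sqrt_mul_sqrt_self A
  obtain ⟨R, hR1, hR2, hR3⟩ := inv_add_one Q hQpos
  -- Q - 1 = (A - 1) R
  have h1 : Q - 1 = (A - 1) * R := by
    have : A - 1 = (Q - 1) * (Q + 1) := by rw [← hQQ]; noncomm_ring
    rw [this, mul_assoc, hR1, mul_one]
  have h2 : ‖Q - 1‖ ≤ ‖A - 1‖ := by
    rw [h1]
    calc _ ≤ ‖A - 1‖ * ‖R‖ := norm_mul_le _ _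
      _ ≤ ‖A - 1‖ * 1 := by gcongr
      _ = _ := mul_one _
  have h3 : Q - 1 ∈ Cpt E E := by rw [h1]; exact Cpt_comp_right hC R
  -- invertibility of Q
  have h4 : ‖1 - Q‖ ≤ 1 / 2 := by rw [norm_sub_rev]; exact h2.trans hn
  obtain ⟨P, hP1, hP2⟩ : ∃ P : E →L[ℂ] E, Q * P = 1 ∧ P * Q = 1 := by
    have := Units.oneSub (1 - Q) (h4.trans_lt (by norm_num))
    have hu : IsUnit Q := by
      have h := (Units.oneSub (1 - Q) (h4.trans_lt (by norm_num))).isUnit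
      simpa using h
    obtain ⟨u, hu⟩ := hu
    exact ⟨↑u⁻¹, by rw [← hu]; simp, by rw [← hu]; simp⟩
  have hQsa : adjoint Q = Q := (IsSelfAdjoint.of_nonneg hQpos)
  have hPsa : adjoint P = P := by
    have e1 : adjoint P * Q = 1 := by
      have := congrArg star hP1
      rw [star_mul, star_one, star_eq_adjoint, star_eq_adjoint, hQsa] at this
      exact this
    calc adjoint P = adjoint P * (Q * P) := by rw [hP1, mul_one]
      _ = P := by rw [← mul_assoc, e1, one_mul]
  have hiso : adjoint (V ∘L P) ∘L (V ∘L P) = 1 := by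
    rw [adjoint_comp, hPsa]
    have : P * (A * P) = 1 := by rw [← hQQ, mul_assoc, hP1, mul_one, hP2]
    exact this
  have hdiff : V ∘L P - V = - ((V ∘L P) ∘L (Q - 1)) := by
    have : P * (Q - 1) = 1 - P := by rw [mul_sub, hP2, mul_one]
    rw [ContinuousLinearMap.comp_assoc]
    change _ = - (V ∘L (P * (Q - 1)))
    rw [this]
    ext x; simp
  refine ⟨V ∘L P, hiso, ?_, ?_⟩
  · rw [hdiff]; exact neg_mem (Cpt_comp_left h3 _)
  · rw [hdiff, norm_neg]
    have hn1 : ‖V ∘L P‖ ≤ 1 := by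
      have : ‖V ∘L P‖ * ‖V ∘L P‖ ≤ 1 := by
        rw [← ContinuousLinearMap.norm_adjoint_comp_self, hiso]
        exact ContinuousLinearMap.norm_id_le
      nlinarith [norm_nonneg (V ∘L P)]
    calc _ ≤ ‖V ∘L P‖ * ‖Q - 1‖ := ContinuousLinearMap.opNorm_comp_le _ _
      _ ≤ 1 * ‖A - 1‖ := by gcongr
      _ ≤ _ := by linarith [norm_nonneg (A - 1)]

lemma glue_sum (g : ℕ → E →L[ℂ] F) (Z : ℕ → E →L[ℂ] H) (η : ℕ → ℝ) (hη0 : ∀ i, 0 ≤ η i)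
    {s : ℝ} (hη : HasSum η s)
    (hg : ∀ x, HasSum (fun i => ‖g i x‖ ^ 2) (‖x‖ ^ 2))
    (hZ : ∀ i, Z i ∈ FRD E (⊤ : Submodule ℂ H)) (hgF : ∀ i, g i ∈ FRD E (⊤ : Submodule ℂ F))
    (h1 : ∀ i, ‖adjoint (Z i) ∘L Z i - adjoint (g i) ∘L g i‖ ≤ η i * η i)
    (h2 : ∀ i j, i ≠ j → ‖adjoint (Z i) ∘L Z j‖ ≤ η i * η j) :
    ∃ V : E →L[ℂ] H, (∀ x, HasSum (fun i => Z i x) (V x)) ∧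
      adjoint V ∘L V - 1 ∈ Cpt E E ∧ ‖adjoint V ∘L V - 1‖ ≤ s * s := by
  classical
  set Δ : ℕ × ℕ → E →L[ℂ] E := fun p =>
    adjoint (Z p.1) ∘L Z p.2 - if p.1 = p.2 then adjoint (g p.1) ∘L g p.1 else 0 with hΔ
  have hΔn : ∀ p, ‖Δ p‖ ≤ η p.1 * η p.2 := by
    rintro ⟨i, j⟩
    by_cases hij : i = j
    · subst hij; simpa [hΔ] using h1 i
    · simpa [hΔ, hij] using h2 i j hij
  have hΔC : ∀ p, Δ p ∈ Cpt E E := by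
    rintro ⟨i, j⟩
    refine sub_mem (FRD_le_Cpt (FRD_comp_left (D' := ⊤) (hZ j) _ (fun _ _ => trivial))) ?_
    split_ifs
    · exact FRD_le_Cpt (FRD_comp_left (D' := ⊤) (hgF i) _ (fun _ _ => trivial))
    · exact zero_mem _
  have hηη : HasSum (fun p : ℕ × ℕ => η p.1 * η p.2) (s * s) :=
    hη.mul hη (hη.summable.mul_of_nonneg hη.summable hη0 hη0)
  have hΔs : Summable Δ := Summable.of_norm_bounded hηη.summable hΔn
  have hdia : ∀ (S : Finset ℕ) x, (∑ p ∈ S ×ˢ S, inner ℂ (Δ p x) x : ℂ) =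
      ((‖∑ i ∈ S, Z i x‖ ^ 2 - ∑ i ∈ S, ‖g i x‖ ^ 2 : ℝ) : ℂ) := by
    intro S x
    have e1 : ∀ p : ℕ × ℕ, inner ℂ (Δ p x) x = inner ℂ (Z p.2 x) (Z p.1 x) -
        if p.1 = p.2 then ((‖g p.1 x‖ ^ 2 : ℝ) : ℂ) else 0 := by
      rintro ⟨i, j⟩
      simp only [hΔ, sub_apply, inner_sub_left, comp_apply, adjoint_inner_left]
      split_ifs
      · simp [adjoint_inner_left]
      · simp
    simp only [e1]
    rw [Finset.sum_sub_distrib, Finset.sum_product, Finset.sum_product]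
    push_cast
    congr 1
    · rw [Finset.sum_comm]
      have h0 : inner ℂ (∑ i ∈ S, Z i x) (∑ i ∈ S, Z i x) = ((‖∑ i ∈ S, Z i x‖ : ℝ) : ℂ) ^ 2 :=
        inner_self_eq_norm_sq_to_K (𝕜 := ℂ) (∑ i ∈ S, Z i x)
      rw [← h0, sum_inner]
      simp [inner_sum]
    · refine Finset.sum_congr rfl fun i hi => ?_
      rw [Finset.sum_ite_eq]; simp [hi]
  have hfin : ∀ (S : Finset ℕ) x, ‖∑ i ∈ S, Z i x‖ ^ 2 ≤
      ∑ i ∈ S, ‖g i x‖ ^ 2 + (∑ i ∈ S, η i) ^ 2 * ‖x‖ ^ 2 := by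
    intro S x
    have e := hdia S x
    have e2 : ‖(∑ p ∈ S ×ˢ S, inner ℂ (Δ p x) x : ℂ)‖ ≤ (∑ i ∈ S, η i) ^ 2 * ‖x‖ ^ 2 := by
      refine (norm_sum_le _ _).trans ?_
      rw [sq, Finset.sum_mul_sum, ← Finset.sum_product', Finset.sum_mul]
      refine Finset.sum_le_sum fun p _ => ?_
      refine (norm_inner_le_norm _ _).trans ?_
      rw [sq, ← mul_assoc]
      gcongr
      exact (le_opNorm _ _).trans (by gcongr; exact hΔn p)
    rw [e, Complex.norm_real] at e2
    linarith [(abs_le.1 e2).2]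
  have hsum : ∀ x, Summable (fun i => Z i x) := by
    intro x
    rw [summable_iff_vanishing_norm]
    intro ε hε
    have hd : 0 < ε ^ 2 / 2 := by positivity
    obtain ⟨S1, hS1⟩ := summable_iff_vanishing_norm.1 (hg x).summable (ε ^ 2 / 2) hd
    have hd2 : 0 < ε / (2 * (‖x‖ + 1)) := by positivity
    obtain ⟨S2, hS2⟩ := summable_iff_vanishing_norm.1 hη.summable _ hd2
    refine ⟨S1 ∪ S2, fun t ht => ?_⟩
    rw [Finset.disjoint_union_right] at ht
    have a1 := hS1 t ht.1
    have a2 := hS2 t ht.2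
    have a3 := hfin t x
    have a4 : (∑ i ∈ t, η i) * ‖x‖ ≤ ε / 2 := by
      have : (∑ i ∈ t, η i) ≤ ε / (2 * (‖x‖ + 1)) := (le_abs_self _).trans a2.le
      calc _ ≤ ε / (2 * (‖x‖ + 1)) * (‖x‖ + 1) := by
            gcongr; linarith
        _ = ε / 2 := by field_simp
    have a5 : 0 ≤ (∑ i ∈ t, η i) * ‖x‖ :=
      mul_nonneg (Finset.sum_nonneg fun i _ => hη0 i) (norm_nonneg _)
    have a6 := (le_abs_self _).trans_lt a1
    refine lt_of_pow_lt_pow_left₀ 2 hε.le ?_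
    rw [← mul_pow] at a3
    nlinarith
  have hb : ∀ x, ‖∑' i, Z i x‖ ≤ Real.sqrt (1 + s ^ 2) * ‖x‖ := by
    intro x
    have t1 : Tendsto (fun S : Finset ℕ => ‖∑ i ∈ S, Z i x‖ ^ 2) atTop
        (𝓝 (‖∑' i, Z i x‖ ^ 2)) := ((hsum x).hasSum.norm).pow 2
    have t2 : Tendsto (fun S : Finset ℕ => ∑ i ∈ S, ‖g i x‖ ^ 2 + (∑ i ∈ S, η i) ^ 2 * ‖x‖ ^ 2)
        atTop (𝓝 (‖x‖ ^ 2 + s ^ 2 * ‖x‖ ^ 2)) :=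
      Tendsto.add (hg x) ((Tendsto.pow hη 2).mul_const _)
    have := le_of_tendsto_of_tendsto' t1 t2 (fun S => hfin S x)
    refine le_of_sq_le_sq ?_ (by positivity)
    rw [mul_pow, Real.sq_sqrt (by positivity)]
    linarith
  let V : E →L[ℂ] H := LinearMap.mkContinuous
    { toFun := fun x => ∑' i, Z i x
      map_add' := fun x y => by
        simp only [map_add]; exact (hsum x).tsum_add (hsum y)
      map_smul' := fun a x => by
        simp only [map_smul, RingHom.id_apply]; exact (hsum x).tsum_const_smul a }
    (Real.sqrt (1 + s ^ 2)) hb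
  have hV : ∀ x, HasSum (fun i => Z i x) (V x) := fun x => (hsum x).hasSum
  have hkey : adjoint V ∘L V - 1 = ∑' p, Δ p := by
    have : ((adjoint V ∘L V - 1 : E →L[ℂ] E) : E →ₗ[ℂ] E) = ((∑' p, Δ p : E →L[ℂ] E) : E →ₗ[ℂ] E) := by
      rw [← ext_inner_map]
      intro x
      have hcont : HasSum (fun p => inner ℂ (Δ p x) x) (inner ℂ ((∑' p, Δ p) x) x) := by
        have h0 : HasSum (fun p => Δ p x) ((∑' p, Δ p) x) :=
          hΔs.hasSum.mapL (ContinuousLinearMap.apply ℂ E x)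
        have h3 := (innerSL ℂ x).hasSum h0
        have h4 := h3.star
        simpa using h4
      have t0 : Tendsto (fun n : ℕ => Finset.range n ×ˢ Finset.range n) atTop atTop :=
        tendsto_atTop_finset_of_monotone
          (fun a b h => Finset.product_subset_product (Finset.range_mono h) (Finset.range_mono h))
          (fun p => ⟨p.1 + p.2 + 1, by simp⟩)
      have t1 := Tendsto.comp hcont t0
      have t2 : Tendsto (fun n : ℕ => ((‖∑ i ∈ Finset.range n, Z i x‖ ^ 2 -
          ∑ i ∈ Finset.range n, ‖g i x‖ ^ 2 : ℝ) : ℂ)) atTop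
          (𝓝 ((‖V x‖ ^ 2 - ‖x‖ ^ 2 : ℝ) : ℂ)) := by
        refine (Complex.continuous_ofReal.tendsto _).comp ?_
        exact (((hV x).tendsto_sum_nat.norm).pow 2).sub (hg x).tendsto_sum_nat
      have t3 : Tendsto (fun n : ℕ => ((‖∑ i ∈ Finset.range n, Z i x‖ ^ 2 -
          ∑ i ∈ Finset.range n, ‖g i x‖ ^ 2 : ℝ) : ℂ)) atTop
          (𝓝 (inner ℂ ((∑' p, Δ p) x) x)) :=
        t1.congr fun n => hdia _ x
      have := tendsto_nhds_unique t2 t3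
      rw [coe_coe, coe_coe, ← this]
      simp [inner_sub_left, adjoint_inner_left]
    exact ContinuousLinearMap.coe_injective this
  refine ⟨V, hV, ?_, ?_⟩
  · rw [hkey]
    exact Cpt_isClosed.mem_of_tendsto hΔs.hasSum
      (Eventually.of_forall fun S => Submodule.sum_mem _ fun p _ => hΔC p)
  · rw [hkey]
    exact tsum_of_norm_bounded hηη hΔn

end VoicB


section VoicC
variable {E F G H K : Type*} [NormedAddCommGroup E] [InnerProductSpace ℂ E] [CompleteSpace E]
  [NormedAddCommGroup K] [InnerProductSpace ℂ K] [CompleteSpace K]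
  [NormedAddCommGroup H] [InnerProductSpace ℂ H] [CompleteSpace H]

lemma step_aux {l : Filter ℕ} (T : H →L[ℂ] H) (X : K →L[ℂ] K) (X' : E →L[ℂ] E)
    (D : Submodule ℂ K) (hDX : ∀ d ∈ D, X d ∈ D) (V : ℕ → K →ₗ[ℂ] H)
    (hV : ∀ x ∈ D, ∀ y ∈ D, Tendsto (fun n => inner ℂ (V n x) (V n y)) l (𝓝 (inner ℂ x y)))
    (hT : ∀ x ∈ D, Tendsto (fun n => T (V n x) - V n (X x)) l (𝓝 0))
    (g : E →L[ℂ] K) (hg : g ∈ FRD E D) (Z : ℕ → E →L[ℂ] H) (hZ : ∀ n x, Z n x = V n (g x))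
    (η : ℝ) (hη : 0 < η) :
    ∀ᶠ n in l, ‖T ∘L Z n - Z n ∘L X'‖ ≤ ‖X ∘L g - g ∘L X'‖ + η := by
  set C := X ∘L g - g ∘L X' with hC
  have hCD : C ∈ FRD E D := sub_mem (FRD_comp_left hg X hDX) (FRD_comp_right hg X')
  choose W hW _ using fun n => FRD_lift hCD (V n)
  have h1 : Tendsto (fun n => T ∘L Z n - Z n ∘L X' - W n) l (𝓝 0) := by
    refine FRD_tendsto hg (fun n => T.toLinearMap ∘ₗ V n - V n ∘ₗ X.toLinearMap) ?_ _ ?_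
    · intro d hd; simpa using hT d hd
    · intro n x; simp [hZ, hW, hC]
  have h2 := FRD_gram hCD V hV W hW
  have h3 : Tendsto (fun n => ‖W n‖ * ‖W n‖) l (𝓝 (‖C‖ * ‖C‖)) := by
    have : Tendsto (fun n => adjoint (W n) ∘L W n) l (𝓝 (adjoint C ∘L C)) := by
      simpa using h2.add_const (adjoint C ∘L C)
    simpa only [norm_adjoint_comp_self] using this.norm
  have h4 : ∀ᶠ n in l, ‖W n‖ * ‖W n‖ < (‖C‖ + η / 2) * (‖C‖ + η / 2) :=
    h3.eventually (gt_mem_nhds (by nlinarith [norm_nonneg C]))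
  have h5 : ∀ᶠ n in l, ‖T ∘L Z n - Z n ∘L X' - W n‖ < η / 2 := by
    have := h1.norm; rw [norm_zero] at this
    exact this.eventually (gt_mem_nhds (by linarith))
  filter_upwards [h4, h5] with n h4 h5
  have h6 : ‖W n‖ < ‖C‖ + η / 2 := by
    by_contra hcon; push Not at hcon
    nlinarith [norm_nonneg C]
  calc ‖T ∘L Z n - Z n ∘L X'‖ = ‖(T ∘L Z n - Z n ∘L X' - W n) + W n‖ := by rw [sub_add_cancel]
    _ ≤ _ := norm_add_le _ _
    _ ≤ ‖C‖ + η := by linarith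

lemma step_lemma {l : Filter ℕ} [NeBot l] (T : H →L[ℂ] H) (X : K →L[ℂ] K) (X' : E →L[ℂ] E)
    (D : Submodule ℂ K) (hDX : ∀ d ∈ D, X d ∈ D) (hDX' : ∀ d ∈ D, adjoint X d ∈ D)
    (V : ℕ → K →ₗ[ℂ] H)
    (hV : ∀ x ∈ D, ∀ y ∈ D, Tendsto (fun n => inner ℂ (V n x) (V n y)) l (𝓝 (inner ℂ x y)))
    (hw : ∀ x ∈ D, ∀ h, Tendsto (fun n => inner ℂ h (V n x)) l (𝓝 0))
    (hT : ∀ x ∈ D, Tendsto (fun n => T (V n x) - V n (X x)) l (𝓝 0))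
    (hT' : ∀ x ∈ D, Tendsto (fun n => adjoint T (V n x) - V n (adjoint X x)) l (𝓝 0))
    (g : E →L[ℂ] K) (hg : g ∈ FRD E D) (L : List (E →L[ℂ] H))
    (hL : ∀ B ∈ L, B ∈ FRD E (⊤ : Submodule ℂ H)) (η : ℝ) (hη : 0 < η) :
    ∃ Z ∈ FRD E (⊤ : Submodule ℂ H), ‖adjoint Z ∘L Z - adjoint g ∘L g‖ ≤ η ∧
      (∀ B ∈ L, ‖adjoint B ∘L Z‖ ≤ η) ∧
      ‖T ∘L Z - Z ∘L X'‖ ≤ ‖X ∘L g - g ∘L X'‖ + η ∧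
      ‖adjoint T ∘L Z - Z ∘L adjoint X'‖ ≤ ‖adjoint X ∘L g - g ∘L adjoint X'‖ + η := by
  choose Z hZ hZF using fun n => FRD_lift hg (V n)
  have e1 := step_aux T X X' D hDX V hV hT g hg Z hZ η hη
  have e2 := step_aux (adjoint T) (adjoint X) (adjoint X') D hDX' V hV hT' g hg Z hZ η hη
  have e3 : ∀ᶠ n in l, ‖adjoint (Z n) ∘L Z n - adjoint g ∘L g‖ < η := by
    have := (FRD_gram hg V hV Z hZ).norm; rw [norm_zero] at this
    exact this.eventually (gt_mem_nhds hη)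
  have e4 : ∀ᶠ n in l, ∀ B ∈ L, ‖adjoint B ∘L Z n‖ ≤ η := by
    have : ∀ B ∈ L, ∀ᶠ n in l, ‖adjoint B ∘L Z n‖ ≤ η := by
      intro B hB
      have := (FRD_weak hg V hw B (hL B hB) Z hZ).norm; rw [norm_zero] at this
      exact (this.eventually (gt_mem_nhds hη)).mono fun _ h => h.le
    have h' := (Filter.eventually_all_finite (List.finite_toSet L)).2 this
    exact h'
  obtain ⟨n, h1, h2, h3, h4⟩ := (e1.and (e2.and (e3.and e4))).exists
  exact ⟨Z n, hZF n, h3.le, h4, h1, h2⟩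

lemma finish_aux (T : H →L[ℂ] H) (X' : E →L[ℂ] E) (Z : ℕ → E →L[ℂ] H)
    (hZ : ∀ i, Z i ∈ FRD E (⊤ : Submodule ℂ H)) (V : E →L[ℂ] H)
    (hV : ∀ x, HasSum (fun i => Z i x) (V x)) (b : ℕ → ℝ) {s : ℝ} (hb : HasSum b s)
    (h : ∀ i, ‖T ∘L Z i - Z i ∘L X'‖ ≤ b i) (V' : E →L[ℂ] H) (hV' : V' - V ∈ Cpt E H)
    (r : ℝ) (hr : ‖V' - V‖ ≤ r) :
    T ∘L V' - V' ∘L X' ∈ Cpt E H ∧ ‖T ∘L V' - V' ∘L X'‖ ≤ s + r * (‖T‖ + ‖X'‖) := by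
  have hs : Summable (fun i => T ∘L Z i - Z i ∘L X') := Summable.of_norm_bounded hb.summable h
  have h1 : T ∘L V - V ∘L X' = ∑' i, (T ∘L Z i - Z i ∘L X') := by
    ext x
    have a1 : HasSum (fun i => (T ∘L Z i - Z i ∘L X') x) ((∑' i, (T ∘L Z i - Z i ∘L X')) x) :=
      hs.hasSum.mapL (ContinuousLinearMap.apply ℂ H x)
    have a2 : HasSum (fun i => (T ∘L Z i - Z i ∘L X') x) (T (V x) - V (X' x)) :=
      (T.hasSum (hV x)).sub (hV (X' x))
    exact a2.unique a1
  have h2 : T ∘L V - V ∘L X' ∈ Cpt E H := by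
    rw [h1]
    refine Cpt_isClosed.mem_of_tendsto hs.hasSum
      (Eventually.of_forall fun S => Submodule.sum_mem _ fun i _ => ?_)
    exact sub_mem (FRD_le_Cpt (FRD_comp_left (D' := ⊤) (hZ i) _ (fun _ _ => trivial)))
      (FRD_le_Cpt (FRD_comp_right (hZ i) _))
  have h3 : ‖T ∘L V - V ∘L X'‖ ≤ s := by rw [h1]; exact tsum_of_norm_bounded hb h
  have h4 : T ∘L V' - V' ∘L X' = (T ∘L V - V ∘L X') + (T ∘L (V' - V) - (V' - V) ∘L X') := by
    ext x; simp; abel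
  refine ⟨?_, ?_⟩
  · rw [h4]
    exact add_mem h2 (sub_mem (Cpt_comp_left hV' _) (Cpt_comp_right hV' _))
  · rw [h4]
    have a1 := opNorm_comp_le T (V' - V)
    have a2 := opNorm_comp_le (V' - V) X'
    have a3 := norm_sub_le (T ∘L (V' - V)) ((V' - V) ∘L X')
    have a4 := norm_add_le (T ∘L V - V ∘L X') (T ∘L (V' - V) - (V' - V) ∘L X')
    have a5 : ‖T‖ * ‖V' - V‖ ≤ ‖T‖ * r := by gcongr
    have a6 : ‖V' - V‖ * ‖X'‖ ≤ r * ‖X'‖ := by gcongr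
    linarith

theorem exists_isometry {l : Filter ℕ} [NeBot l] (T : H →L[ℂ] H) (X : K →L[ℂ] K) (X' : E →L[ℂ] E)
    (D : Submodule ℂ K) (hDX : ∀ d ∈ D, X d ∈ D) (hDX' : ∀ d ∈ D, adjoint X d ∈ D)
    (V : ℕ → K →ₗ[ℂ] H)
    (hV : ∀ x ∈ D, ∀ y ∈ D, Tendsto (fun n => inner ℂ (V n x) (V n y)) l (𝓝 (inner ℂ x y)))
    (hw : ∀ x ∈ D, ∀ h, Tendsto (fun n => inner ℂ h (V n x)) l (𝓝 0))
    (hT : ∀ x ∈ D, Tendsto (fun n => T (V n x) - V n (X x)) l (𝓝 0))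
    (hT' : ∀ x ∈ D, Tendsto (fun n => adjoint T (V n x) - V n (adjoint X x)) l (𝓝 0))
    (g : ℕ → E →L[ℂ] K) (hg : ∀ i, g i ∈ FRD E D)
    (hP : ∀ x, HasSum (fun i => ‖g i x‖ ^ 2) (‖x‖ ^ 2))
    (δ : ℕ → ℝ) {d : ℝ} (hδ : HasSum δ d)
    (hg1 : ∀ i, ‖X ∘L g i - g i ∘L X'‖ ≤ δ i)
    (hg2 : ∀ i, ‖adjoint X ∘L g i - g i ∘L adjoint X'‖ ≤ δ i) (ε : ℝ) (hε : 0 < ε) :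
    ∃ W : E →L[ℂ] H, adjoint W ∘L W = 1 ∧
      T ∘L W - W ∘L X' ∈ Cpt E H ∧ ‖T ∘L W - W ∘L X'‖ ≤ d + ε ∧
      adjoint T ∘L W - W ∘L adjoint X' ∈ Cpt E H ∧
      ‖adjoint T ∘L W - W ∘L adjoint X'‖ ≤ d + ε := by
  set η0 : ℝ := min (1 / 2) (ε / (1 + 2 * (‖T‖ + ‖X'‖))) with hη0
  have hden : 0 < 1 + 2 * (‖T‖ + ‖X'‖) := by positivity
  have hη0pos : 0 < η0 := by
    rw [hη0]; exact lt_min (by norm_num) (by positivity)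
  have hη0half : η0 ≤ 1 / 2 := min_le_left _ _
  have hη0ε : η0 * (1 + 2 * (‖T‖ + ‖X'‖)) ≤ ε := by
    rw [← le_div_iff₀ hden]; exact min_le_right _ _
  set η : ℕ → ℝ := fun i => η0 / 2 / 2 ^ i with hη
  have hηpos : ∀ i, 0 < η i := fun i => by rw [hη]; positivity
  have hηsum : HasSum η η0 := hasSum_geometric_two' η0
  have hηanti : ∀ i j, i ≤ j → η j ≤ η i := by
    intro i j hij
    simp only [hη]
    gcongr
    norm_num
  have hη1 : ∀ i, η i ≤ 1 := by
    intro i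
    refine (hηanti 0 i (Nat.zero_le _)).trans ?_
    simp only [hη]; norm_num; linarith
  have hstep : ∀ (i : ℕ) (L : List (E →L[ℂ] H)), ∃ Z : E →L[ℂ] H,
      (∀ B ∈ L, B ∈ FRD E (⊤ : Submodule ℂ H)) → 
      Z ∈ FRD E (⊤ : Submodule ℂ H) ∧ ‖adjoint Z ∘L Z - adjoint (g i) ∘L g i‖ ≤ η i * η i ∧
      (∀ B ∈ L, ‖adjoint B ∘L Z‖ ≤ η i * η i) ∧
      ‖T ∘L Z - Z ∘L X'‖ ≤ ‖X ∘L g i - g i ∘L X'‖ + η i * η i ∧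
      ‖adjoint T ∘L Z - Z ∘L adjoint X'‖ ≤ ‖adjoint X ∘L g i - g i ∘L adjoint X'‖ + η i * η i := by
    intro i L
    by_cases hL : ∀ B ∈ L, B ∈ FRD E (⊤ : Submodule ℂ H)
    · obtain ⟨Z, h0, h⟩ := step_lemma T X X' D hDX hDX' V hV hw hT hT' (g i) (hg i) L hL
        (η i * η i) (mul_pos (hηpos i) (hηpos i))
      exact ⟨Z, fun _ => ⟨h0, h⟩⟩
    · exact ⟨0, fun h => absurd h hL⟩
  choose st hst using hstep
  let L : ℕ → List (E →L[ℂ] H) := fun i => Nat.rec [] (fun i L => st i L :: L) i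
  have hLs : ∀ i, L (i + 1) = st i (L i) :: L i := fun i => rfl
  set Z : ℕ → E →L[ℂ] H := fun i => st i (L i) with hZ
  have hLF : ∀ i, ∀ B ∈ L i, B ∈ FRD E (⊤ : Submodule ℂ H) := by
    intro i
    induction i with
    | zero => intro B hB; simp [L] at hB
    | succ i ih =>
      intro B hB
      rw [hLs, List.mem_cons] at hB
      rcases hB with rfl | hB
      · exact (hst i (L i) ih).1
      · exact ih B hB
  have hZL : ∀ i j, j < i → Z j ∈ L i := by
    intro i
    induction i with
    | zero => intro j hj; omega
    | succ i ih =>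
      intro j hj
      rw [hLs, List.mem_cons]
      rcases Nat.lt_succ_iff_lt_or_eq.1 hj with h | h
      · exact Or.inr (ih j h)
      · subst h; exact Or.inl rfl
  have hZs := fun i => hst i (L i) (hLF i)
  have horth : ∀ i j, i < j → ‖adjoint (Z i) ∘L Z j‖ ≤ η i * η j := by
    intro i j hij
    refine ((hZs j).2.2.1 _ (hZL j i hij)).trans ?_
    exact mul_le_mul_of_nonneg_right (hηanti i j hij.le) (hηpos j).le
  obtain ⟨V0, hV0, hV0C, hV0n⟩ := glue_sum g Z η (fun i => (hηpos i).le) hηsum hP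
    (fun i => (hZs i).1) (fun i => FRD_le_top (hg i)) (fun i => (hZs i).2.1) (by
      intro i j hij
      rcases lt_or_gt_of_ne hij with h | h
      · exact horth i j h
      · have : adjoint (Z i) ∘L Z j = adjoint (adjoint (Z j) ∘L Z i) := by
          rw [adjoint_comp, adjoint_adjoint]
        rw [this, LinearIsometryEquiv.norm_map, mul_comm]
        exact horth j i h)
  have hsq : η0 * η0 ≤ η0 := by nlinarith
  obtain ⟨W, hW, hWC, hWn⟩ := polar_fix V0 hV0C (hV0n.trans (by nlinarith))
  have hWn' : ‖W - V0‖ ≤ 2 * η0 := hWn.trans (by linarith)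
  have hb : HasSum (fun i => δ i + η i) (d + η0) := hδ.add hηsum
  have hηη : ∀ i, η i * η i ≤ η i := fun i => by nlinarith [hηpos i, hη1 i]
  obtain ⟨c1, c2⟩ := finish_aux T X' Z (fun i => (hZs i).1) V0 hV0 _ hb
    (fun i => (hZs i).2.2.2.1.trans (by linarith [hg1 i, hηη i])) W hWC _ hWn'
  obtain ⟨c3, c4⟩ := finish_aux (adjoint T) (adjoint X') Z (fun i => (hZs i).1) V0 hV0 _ hb
    (fun i => (hZs i).2.2.2.2.trans (by linarith [hg2 i, hηη i])) W hWC _ hWn'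
  rw [LinearIsometryEquiv.norm_map, LinearIsometryEquiv.norm_map] at c4
  exact ⟨W, hW, c1, by linarith, c3, by linarith⟩

end VoicC



lemma ramp_lip (c : ℝ) (hc : 0 < c) (n : ℕ) :
    |max 0 (min 1 (2 - (n:ℝ) / c)) - max 0 (min 1 (2 - ((n+1 : ℕ):ℝ) / c))| ≤ 1 / c := by
  have h1 : |(2 - (n:ℝ) / c) - (2 - ((n+1 : ℕ):ℝ) / c)| ≤ 1 / c := by
    have : (2 - (n:ℝ) / c) - (2 - ((n+1 : ℕ):ℝ) / c) = 1 / c := by push_cast; ring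
    rw [this, abs_of_pos (by positivity)]
  refine le_trans ?_ h1
  refine (abs_max_sub_max_le_max _ _ _ _).trans ?_
  simp only [sub_self, abs_zero, abs_nonneg, max_eq_right]
  refine (abs_min_sub_min_le_max _ _ _ _).trans ?_
  simp

lemma abs_sqrt_sub_le (x y : ℝ) (hx : 0 ≤ x) (hy : 0 ≤ y) : |√x - √y| ≤ √|x - y| := by
  apply Real.le_sqrt_of_sq_le
  rw [sq_abs]
  have h1 := Real.sq_sqrt hx
  have h2 := Real.sq_sqrt hy
  have h3 := Real.sqrt_nonneg x
  have h4 := Real.sqrt_nonneg y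
  rcases le_total (√x) (√y) with h | h
  · have := neg_abs_le (x - y)
    nlinarith
  · have := le_abs_self (x - y)
    nlinarith

lemma exists_phi (η : ℝ) (hη : 0 < η) : ∃ φ : ℕ → ℕ → ℝ, (∀ k, ∃ L, ∀ n ≥ L, φ k n = 0) ∧
    (∀ k n, |φ k n - φ k (n+1)| ≤ η / 2^k) ∧ (∀ N n, ∑ k ∈ Finset.range N, φ k n ^ 2 ≤ 1) ∧
    (∀ N n, n < N → ∑ k ∈ Finset.range N, φ k n ^ 2 = 1) := by
  wlog hη1 : η ≤ 1 generalizing η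
  · obtain ⟨φ, h1, h2, h3, h4⟩ := this 1 one_pos le_rfl
    refine ⟨φ, h1, fun k n => (h2 k n).trans ?_, h3, h4⟩
    gcongr
    exact (not_le.1 hη1).le
  set C : ℝ := 2 / η^2 with hC
  have hC0 : 0 < C := by positivity
  have hC1 : 1 ≤ C := by
    rw [hC, le_div_iff₀ (by positivity)]; nlinarith
  let r : ℕ → ℕ → ℝ := fun k n => max 0 (min 1 (2 - (n:ℝ) / (C * 4^k)))
  let a : ℕ → ℕ → ℝ := fun k n => if k = 0 then 0 else r k n
  have hr0 : ∀ k n, 0 ≤ r k n := fun k n => le_max_left _ _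
  have hr1 : ∀ k n, r k n ≤ 1 := fun k n => max_le zero_le_one (min_le_left _ _)
  have hlip : ∀ k n, |a k n - a k (n+1)| ≤ 1 / (C * 4^k) := by
    intro k n
    by_cases hk : k = 0
    · simp only [a, hk, if_true]; simp; positivity
    · simp only [a, hk, if_false]; exact ramp_lip _ (by positivity) n
  have hmono : ∀ k n, a k n ≤ a (k+1) n := by
    intro k n
    by_cases hk : k = 0
    · simp only [a, hk, if_true]; simpa using hr0 _ _
    · simp only [a, hk, if_false]
      simp only [Nat.add_eq_zero_iff, one_ne_zero, and_false, if_false, r]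
      gcongr
      · norm_num
      · simp
  have ha1 : ∀ k n, a k n ≤ 1 := by
    intro k n; simp only [a]; split_ifs
    · norm_num
    · exact hr1 _ _
  have hsum : ∀ N n, ∑ k ∈ Finset.range N, (√(a (k+1) n - a k n)) ^ 2 = a N n := by
    intro N n
    have : ∀ k, (√(a (k+1) n - a k n)) ^ 2 = a (k+1) n - a k n := fun k =>
      Real.sq_sqrt (sub_nonneg.2 (hmono k n))
    simp only [this]
    rw [Finset.sum_range_sub (fun k => a k n)]
    simp [a]
  refine ⟨fun k n => √(a (k+1) n - a k n), ?_, ?_, ?_, ?_⟩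
  · intro k
    refine ⟨⌈2 * (C * 4^(k+1))⌉₊, fun n hn => ?_⟩
    have hz : a (k+1) n = 0 := by
      simp only [a, Nat.add_eq_zero_iff, one_ne_zero, and_false, if_false, r]
      apply max_eq_left
      refine (min_le_right _ _).trans ?_
      have h1 := Nat.ceil_le.1 hn
      rw [sub_nonpos, le_div_iff₀ (by positivity)]
      exact h1
    apply Real.sqrt_eq_zero_of_nonpos
    rw [hz]
    have : 0 ≤ a k n := by simp only [a]; split_ifs; exacts [le_rfl, hr0 _ _]
    linarith
  · intro k n
    refine (abs_sqrt_sub_le _ _ (sub_nonneg.2 (hmono _ _)) (sub_nonneg.2 (hmono _ _))).trans ?_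
    apply Real.sqrt_le_iff.2 ⟨by positivity, ?_⟩
    have e : (a (k+1) n - a k n) - (a (k+1) (n+1) - a k (n+1))
      = (a (k+1) n - a (k+1) (n+1)) - (a k n - a k (n+1)) := by ring
    rw [e]
    refine (abs_sub _ _).trans ((add_le_add (hlip _ _) (hlip _ _)).trans ?_)
    have e2 : (η / 2^k)^2 = 2 / (C * 4^k) := by
      rw [hC, div_pow, ← pow_mul, mul_comm k 2, pow_mul]; norm_num; field_simp
    rw [e2]
    have h1 : 1 / (C * 4^(k+1)) ≤ 1 / (C * 4^k) := by
      gcongr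
      · norm_num
      · simp
    have h2 : 2 / (C * 4^k) = 1 / (C * 4^k) + 1 / (C * 4^k) := by ring
    linarith
  · intro N n
    rw [hsum]; exact ha1 _ _
  · intro N n hn
    rw [hsum]
    have : N ≠ 0 := by omega
    simp only [a, this, if_false, r]
    have h1 : (n:ℝ) / (C * 4^N) ≤ 1 := by
      rw [div_le_one (by positivity)]
      have h2 : (n:ℝ) ≤ 4^N := by
        have : n ≤ 4^N := hn.le.trans (Nat.lt_pow_self (by norm_num)).le
        exact_mod_cast this
      nlinarith
    rw [min_eq_left (by linarith)]; simp

section flag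
variable {K : Type*} [NormedAddCommGroup K] [InnerProductSpace ℂ K] [CompleteSpace K]

lemma exists_flag [TopologicalSpace.SeparableSpace K] (X : K →L[ℂ] K) (D : Submodule ℂ K)
    (hD : Dense (D : Set K)) (h1 : ∀ d ∈ D, X d ∈ D) (h2 : ∀ d ∈ D, adjoint X d ∈ D) :
    ∃ E : ℕ → Submodule ℂ K, E 0 = ⊥ ∧ Monotone E ∧ (∀ n, FiniteDimensional ℂ (E n)) ∧
      (∀ n, E n ≤ D) ∧ (∀ n, ∀ x ∈ E n, X x ∈ E (n+1)) ∧
      (∀ n, ∀ x ∈ E n, adjoint X x ∈ E (n+1)) ∧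
      Dense ((⨆ n, E n : Submodule ℂ K) : Set K) := by
  have : TopologicalSpace.SeparableSpace D := TopologicalSpace.SecondCountableTopology.to_separableSpace
  obtain ⟨b, hb⟩ := TopologicalSpace.exists_dense_seq D
  let E : ℕ → Submodule ℂ K := fun n => Nat.rec ⊥ (fun n A => A ⊔
    A.map (X : K →ₗ[ℂ] K) ⊔ A.map (adjoint X : K →ₗ[ℂ] K) ⊔ Submodule.span ℂ {(b n : K)}) n
  have hE : ∀ n, E (n+1) = E n ⊔ (E n).map (X : K →ₗ[ℂ] K) ⊔
    (E n).map (adjoint X : K →ₗ[ℂ] K) ⊔ Submodule.span ℂ {(b n : K)} := fun n => rfl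
  refine ⟨E, rfl, monotone_nat_of_le_succ ?_, ?_, ?_, ?_, ?_, ?_⟩
  · intro n; rw [hE]
    exact le_sup_of_le_left (le_sup_of_le_left le_sup_left)
  · intro n
    induction n with
    | zero => exact inferInstanceAs (FiniteDimensional ℂ (⊥ : Submodule ℂ K))
    | succ n ih => 
      rw [hE]
      have hfd : ∀ A : Submodule ℂ K, FiniteDimensional ℂ A → FiniteDimensional ℂ
          (A ⊔ A.map (X : K →ₗ[ℂ] K) ⊔ A.map (adjoint X : K →ₗ[ℂ] K) ⊔
            Submodule.span ℂ {(b n : K)} : Submodule ℂ K) := by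
        intro A hA; infer_instance
      exact hfd _ ih
  · intro n
    induction n with
    | zero => exact bot_le
    | succ n ih =>
      rw [hE]
      refine sup_le (sup_le (sup_le ih ?_) ?_) ?_
      · rintro _ ⟨x, hx, rfl⟩; exact h1 x (ih hx)
      · rintro _ ⟨x, hx, rfl⟩; exact h2 x (ih hx)
      · rw [Submodule.span_singleton_le_iff_mem]; exact (b n).2
  · intro n x hx
    rw [hE]
    exact Submodule.mem_sup_left (Submodule.mem_sup_left (Submodule.mem_sup_right ⟨x, hx, rfl⟩))
  · intro n x hx
    rw [hE]
    exact Submodule.mem_sup_left (Submodule.mem_sup_right ⟨x, hx, rfl⟩)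
  · have : Dense (Set.range (fun n => (b n : K))) := by
      exact DenseRange.comp (g := ((↑) : D → K)) hD.denseRange_val hb continuous_subtype_val
    refine this.mono ?_
    rintro _ ⟨n, rfl⟩
    have : (b n : K) ∈ E (n+1) := by
      rw [hE]; exact Submodule.mem_sup_right (Submodule.mem_span_singleton_self _)
    exact (le_iSup E (n+1)) this


lemma flag_pyth {E : ℕ → Submodule ℂ K} (hm : Monotone E) (w : ℕ → K)
    (h1 : ∀ n, w n ∈ E (n+1)) (h2 : ∀ n, w n ∈ (E n)ᗮ) (L : ℕ) :
    ‖∑ n ∈ Finset.range L, w n‖^2 = ∑ n ∈ Finset.range L, ‖w n‖^2 := by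
  induction L with
  | zero => simp
  | succ L ih =>
    rw [Finset.sum_range_succ, Finset.sum_range_succ, ← ih]
    have hs : ∑ n ∈ Finset.range L, w n ∈ E L :=
      Submodule.sum_mem _ fun n hn => hm (Nat.succ_le_of_lt (Finset.mem_range.1 hn)) (h1 n)
    have h0 : inner ℂ (∑ n ∈ Finset.range L, w n) (w L) = 0 := (h2 L) _ hs
    have := norm_add_sq (𝕜 := ℂ) (∑ n ∈ Finset.range L, w n) (w L)
    rw [this, h0]; simp

lemma flag_norm {E : ℕ → Submodule ℂ K} (hm : Monotone E)
    [∀ n, FiniteDimensional ℂ (E n)] (Y : K →L[ℂ] K) (hY : ∀ n, ∀ x ∈ E n, Y x ∈ E (n+1))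
    (hE0 : E 0 = ⊥)
    (d : ℕ → ℝ) (c : ℝ) (hc : 0 ≤ c) (hd : ∀ n, |d n| ≤ c) (L : ℕ) :
    ‖∑ n ∈ Finset.range L, (d n : ℂ) • (((E (n+2)).starProjection - (E (n+1)).starProjection) ∘L
      Y ∘L (E (n+1)).starProjection)‖ ≤ c * ‖Y‖ := by
  refine ContinuousLinearMap.opNorm_le_bound _ (by positivity) fun x => ?_
  rw [ContinuousLinearMap.sum_apply]
  set P : ℕ → K →L[ℂ] K := fun n => (E n).starProjection with hP
  have hPm : ∀ n x, P n x ∈ E n := fun n x => Submodule.starProjection_apply_mem _ _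
  have hPo : ∀ n x, x - P n x ∈ (E n)ᗮ := fun n x => Submodule.sub_starProjection_mem_orthogonal _
  have hPf : ∀ n x, x ∈ E n → P n x = x := fun n x hx => Submodule.starProjection_eq_self_iff.2 hx
  have hQo : ∀ n x, P (n+1) x - P n x ∈ (E n)ᗮ := by
    intro n x
    have h1 := Submodule.sub_mem _ (hPo n x) (Submodule.orthogonal_le (hm (Nat.le_succ n)) (hPo (n+1) x))
    convert h1 using 1; abel
  have hQm : ∀ n x, P (n+1) x - P n x ∈ E (n+1) := fun n x =>
    Submodule.sub_mem _ (hPm _ _) (hm (Nat.le_succ n) (hPm _ _))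
  have hQn : ∀ n x, ‖P (n+1) x - P n x‖ ≤ ‖x‖ := by
    intro n x
    have h1 : P (n+1) x - P n x = P (n+1) (x - P n x) := by
      rw [map_sub, hPf (n+1) _ (hm (Nat.le_succ n) (hPm n x))]
    have h3 : P (n+1) x - P n x = P (n+1) x - P n (P (n+1) x) := by
      congr 1
      have := Submodule.starProjection_comp_starProjection_of_le (hm (Nat.le_succ n))
      exact (congrArg (fun A => A x) this).symm
    have h4 : P (n+1) x - P n (P (n+1) x) = (E n)ᗮ.starProjection (P (n+1) x) := by
      rw [Submodule.starProjection_orthogonal_val]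
    rw [h3, h4]
    exact (Submodule.norm_starProjection_apply_le _ _).trans (Submodule.norm_starProjection_apply_le _ _)
  have hw : ∀ n, ((d n : ℂ) • ((P (n+2) - P (n+1)) ∘L Y ∘L P (n+1))) x
      = (d n : ℂ) • (P (n+2) (Y (P (n+1) x - P n x)) - P (n+1) (Y (P (n+1) x - P n x))) := by
    intro n
    simp only [ContinuousLinearMap.smul_apply, ContinuousLinearMap.comp_apply,
      ContinuousLinearMap.sub_apply, map_sub]
    have e1 : P (n+1) (Y (P n x)) = Y (P n x) := hPf _ _ (hY _ _ (hPm _ _))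
    have e2 : P (n+2) (Y (P n x)) = Y (P n x) := hPf _ _ (hm (Nat.le_succ _) (hY _ _ (hPm _ _)))
    rw [e1, e2]; congr 1; abel
  have hpyth := flag_pyth (E := fun n => E (n+1)) (fun a b h => hm (by omega))
    (fun n => ((d n : ℂ) • ((P (n+2) - P (n+1)) ∘L Y ∘L P (n+1))) x)
    (fun n => by simp only [hw]; exact Submodule.smul_mem _ _ (hQm (n+1) _))
    (fun n => by simp only [hw]; exact Submodule.smul_mem _ _ (hQo (n+1) _)) L
  have hpyth2 := flag_pyth hm (fun n => P (n+1) x - P n x) (fun n => hQm n x) (fun n => hQo n x) L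
  rw [Finset.sum_range_sub (fun n => P n x)] at hpyth2
  have hP0 : P 0 x = 0 := by
    have := hPm 0 x
    rw [hE0] at this; simpa using this
  rw [hP0, sub_zero] at hpyth2
  have hPL : ‖P L x‖ ≤ ‖x‖ := Submodule.norm_starProjection_apply_le _ _
  refine abs_le_of_sq_le_sq' ?_ (by positivity) |>.2
  refine hpyth.le.trans ?_
  calc _ ≤ ∑ n ∈ Finset.range L, (c * ‖Y‖)^2 * ‖P (n+1) x - P n x‖^2 := by
        refine Finset.sum_le_sum fun n _ => ?_
        simp only [hw]
        rw [norm_smul, Complex.norm_real, ← mul_pow, Real.norm_eq_abs, mul_assoc]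
        gcongr
        · exact hd n
        · exact (hQn (n+1) _).trans (Y.le_opNorm _)
    _ = (c * ‖Y‖)^2 * ‖P L x‖^2 := by rw [← Finset.mul_sum, hpyth2]
    _ ≤ (c * ‖Y‖ * ‖x‖)^2 := by rw [mul_pow _ (‖x‖)]; gcongr


lemma starProjection_FRD (E D : Submodule ℂ K) [FiniteDimensional ℂ E] (h : E ≤ D) :
    E.starProjection ∈ FRD K D := by
  rw [OrthonormalBasis.starProjection_eq_sum_rankOne (stdOrthonormalBasis ℂ E)]
  exact Submodule.sum_mem _ fun i _ => Submodule.subset_span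
    ⟨_, h (stdOrthonormalBasis ℂ E i).2, _, rfl⟩

lemma starProjection_adj (E : Submodule ℂ K) [FiniteDimensional ℂ E] :
    adjoint E.starProjection = E.starProjection :=
  (isSelfAdjoint_starProjection E).star_eq

/-- quasicentral partition of unity -/
lemma exists_partition [TopologicalSpace.SeparableSpace K] (X : K →L[ℂ] K) (D : Submodule ℂ K)
    (hD : Dense (D : Set K)) (h1 : ∀ d ∈ D, X d ∈ D) (h2 : ∀ d ∈ D, adjoint X d ∈ D)
    (ε : ℝ) (hε : 0 < ε) :
    ∃ f : ℕ → K →L[ℂ] K, (∀ k, f k ∈ FRD K D) ∧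
      (∀ x, HasSum (fun k => ‖f k x‖^2) (‖x‖^2)) ∧
      (∀ k, ‖X ∘L f k - f k ∘L X‖ ≤ ε / 2^k) ∧
      (∀ k, ‖adjoint X ∘L f k - f k ∘L adjoint X‖ ≤ ε / 2^k) := by
  obtain ⟨E, hE0, hm, hfd, hED, hX, hX', hdense⟩ := exists_flag X D hD h1 h2
  set η : ℝ := ε / (2 * (‖X‖ + 1)) with hη
  have hη0 : 0 < η := by positivity
  obtain ⟨φ, hφ1, hφ2, hφ3, hφ4⟩ := exists_phi η hη0
  choose L hL using hφ1
  set P : ℕ → K →L[ℂ] K := fun n => (E n).starProjection with hP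
  have hPm : ∀ n x, P n x ∈ E n := fun n x => Submodule.starProjection_apply_mem _ _
  have hPo : ∀ n x, x - P n x ∈ (E n)ᗮ := fun n x => Submodule.sub_starProjection_mem_orthogonal _
  have hPf : ∀ n x, x ∈ E n → P n x = x := fun n x hx => Submodule.starProjection_eq_self_iff.2 hx
  have hQo : ∀ n x, P (n+1) x - P n x ∈ (E n)ᗮ := by
    intro n x
    have h1 := Submodule.sub_mem _ (hPo n x) (Submodule.orthogonal_le (hm (Nat.le_succ n)) (hPo (n+1) x))
    convert h1 using 1; abel
  have hQm : ∀ n x, P (n+1) x - P n x ∈ E (n+1) := fun n x =>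
    Submodule.sub_mem _ (hPm _ _) (hm (Nat.le_succ n) (hPm _ _))
  have hP0 : P 0 = 0 := by
    ext x
    have := hPm 0 x
    rw [hE0] at this; simpa using this
  have hPa : ∀ n, adjoint (P n) = P n := fun n => starProjection_adj (E n)
  have hPX : ∀ (Y : K →L[ℂ] K), (∀ n, ∀ x ∈ E n, Y x ∈ E (n+1)) → ∀ n,
      P (n+1) ∘L Y ∘L P n = Y ∘L P n := by
    intro Y hY n; ext x
    exact hPf _ _ (hY _ _ (hPm _ _))
  let f : ℕ → K →L[ℂ] K := fun k => ∑ n ∈ Finset.range (L k), (φ k n : ℂ) • (P (n+1) - P n)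
  have hf : ∀ k, f k = ∑ n ∈ Finset.range (L k), ((φ k n - φ k (n+1) : ℝ) : ℂ) • P (n+1) := by
    intro k
    have key : ∀ M, ∑ n ∈ Finset.range M, (φ k n : ℂ) • (P (n+1) - P n)
      = ∑ n ∈ Finset.range M, ((φ k n - φ k (n+1) : ℝ) : ℂ) • P (n+1) + (φ k M : ℂ) • P M := by
      intro M
      induction M with
      | zero => simp [hP0]
      | succ M ih =>
        rw [Finset.sum_range_succ, ih, Finset.sum_range_succ]
        push_cast
        module
    change ∑ n ∈ Finset.range (L k), (φ k n : ℂ) • (P (n+1) - P n) = _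
    rw [key, hL k _ le_rfl]; simp
  have hnorm : ∀ k x M, L k ≤ M →
      ‖f k x‖^2 = ∑ n ∈ Finset.range M, φ k n ^2 * ‖P (n+1) x - P n x‖^2 := by
    intro k x M hM
    have e : f k x = ∑ n ∈ Finset.range M, (φ k n : ℂ) • (P (n+1) x - P n x) := by
      have : f k x = ∑ n ∈ Finset.range (L k), (φ k n : ℂ) • (P (n+1) x - P n x) := by
        simp [f]
      rw [this]
      refine Finset.sum_subset (Finset.range_mono hM) ?_
      intro n _ hn
      rw [hL k n (by simpa using hn)]; simp
    rw [e, flag_pyth hm _ (fun n => Submodule.smul_mem _ _ (hQm n x))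
      (fun n => Submodule.smul_mem _ _ (hQo n x))]
    refine Finset.sum_congr rfl fun n _ => ?_
    rw [norm_smul, mul_pow, Complex.norm_real, Real.norm_eq_abs, sq_abs]
  have hPn : ∀ x M, ∑ n ∈ Finset.range M, ‖P (n+1) x - P n x‖^2 = ‖P M x‖^2 := by
    intro x M
    rw [← flag_pyth hm _ (fun n => hQm n x) (fun n => hQo n x),
      Finset.sum_range_sub (fun n => P n x), hP0]; simp
  have hcomm : ∀ Y : K →L[ℂ] K, (∀ n, ∀ x ∈ E n, Y x ∈ E (n+1)) →
      (∀ n, ∀ x ∈ E n, adjoint Y x ∈ E (n+1)) → ‖Y‖ = ‖X‖ → ∀ k,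
      ‖Y ∘L f k - f k ∘L Y‖ ≤ ε / 2^k := by
    intro Y hY hY' hn k
    have hc : ∀ n, Y ∘L P n - P n ∘L Y = (P (n+1) - P n) ∘L Y ∘L P n -
        adjoint ((P (n+1) - P n) ∘L adjoint Y ∘L P n) := by
      intro n
      have e1 := hPX Y hY n
      have e2 := congrArg adjoint (hPX _ hY' n)
      simp only [adjoint_comp, adjoint_adjoint, hPa] at e2
      simp only [adjoint_comp, adjoint_adjoint, map_sub, hPa, ContinuousLinearMap.sub_comp,
        ContinuousLinearMap.comp_sub, e1, e2]
      simp only [ContinuousLinearMap.comp_assoc] at e2 ⊢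
      abel
    have e : Y ∘L f k - f k ∘L Y =
      ∑ n ∈ Finset.range (L k), ((φ k n - φ k (n+1) : ℝ) : ℂ) •
        ((P (n+2) - P (n+1)) ∘L Y ∘L P (n+1)) -
      adjoint (∑ n ∈ Finset.range (L k), ((φ k n - φ k (n+1) : ℝ) : ℂ) •
        ((P (n+2) - P (n+1)) ∘L adjoint Y ∘L P (n+1))) := by
      rw [hf, ContinuousLinearMap.comp_finset_sum, ContinuousLinearMap.finset_sum_comp,
        map_sum, ← Finset.sum_sub_distrib, ← Finset.sum_sub_distrib]
      refine Finset.sum_congr rfl fun n _ => ?_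
      rw [ContinuousLinearMap.comp_smul, ContinuousLinearMap.smul_comp, map_smulₛₗ,
        Complex.conj_ofReal, ← smul_sub, ← smul_sub, hc]
    rw [e]
    have b1 := flag_norm hm Y hY hE0 (fun n => φ k n - φ k (n+1)) (η / 2^k) (by positivity)
      (hφ2 k) (L k)
    have b2 := flag_norm hm (adjoint Y) hY' hE0 (fun n => φ k n - φ k (n+1)) (η / 2^k)
      (by positivity) (hφ2 k) (L k)
    refine (norm_sub_le _ _).trans ?_
    rw [LinearIsometryEquiv.norm_map]
    rw [LinearIsometryEquiv.norm_map, hn] at b2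
    rw [hn] at b1
    refine (add_le_add b1 b2).trans ?_
    have : η * (2 * (‖X‖ + 1)) = ε := by rw [hη]; field_simp
    rw [← this]
    have h3 : 0 ≤ η / 2^k := by positivity
    have h4 : η * (2 * (‖X‖ + 1)) / 2^k = η / 2^k * (2 * (‖X‖ + 1)) := by ring
    rw [h4]
    nlinarith [norm_nonneg X]
  refine ⟨f, ?_, ?_, hcomm X hX hX' rfl, hcomm (adjoint X) hX' (by simpa using hX) (by simp)⟩
  · intro k
    rw [hf]
    exact Submodule.sum_mem _ fun n _ => Submodule.smul_mem _ _ (starProjection_FRD _ _ (hED _))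
  · intro x
    rw [hasSum_iff_tendsto_nat_of_nonneg (fun k => by positivity)]
    have hlim : Tendsto (fun n => ‖P n x‖^2) atTop (𝓝 (‖x‖^2)) := by
      have := Submodule.starProjection_tendsto_self E hm x
        (by rw [Submodule.dense_iff_topologicalClosure_eq_top.1 hdense])
      exact (this.norm).pow 2
    have hsw : ∀ N, ∃ M, N ≤ M ∧ ∑ k ∈ Finset.range N, ‖f k x‖^2 =
        ∑ n ∈ Finset.range M, (∑ k ∈ Finset.range N, φ k n ^ 2) * ‖P (n+1) x - P n x‖^2 := by
      intro N
      refine ⟨N + ∑ k ∈ Finset.range N, L k, by omega, ?_⟩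
      simp only [Finset.sum_mul]
      rw [Finset.sum_comm]
      refine Finset.sum_congr rfl fun k hk => hnorm k x _ ?_
      have := Finset.single_le_sum (f := L) (fun i _ => Nat.zero_le _) hk
      omega
    refine tendsto_of_tendsto_of_tendsto_of_le_of_le hlim tendsto_const_nhds ?_ ?_
    · intro N
      obtain ⟨M, hNM, hM⟩ := hsw N
      simp only [hM, ← hPn]
      calc _ = ∑ n ∈ Finset.range N, (∑ k ∈ Finset.range N, φ k n ^ 2) * ‖P (n+1) x - P n x‖^2 := by
            refine Finset.sum_congr rfl fun n hn => ?_
            rw [hφ4 N n (Finset.mem_range.1 hn), one_mul]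
        _ ≤ _ := Finset.sum_le_sum_of_subset_of_nonneg (Finset.range_mono hNM)
            fun _ _ _ => by positivity
    · intro N
      obtain ⟨M, hNM, hM⟩ := hsw N
      simp only [hM]
      calc _ ≤ ∑ n ∈ Finset.range M, ‖P (n+1) x - P n x‖^2 := by
            refine Finset.sum_le_sum fun n _ => ?_
            have := hφ3 N n
            nlinarith [sq_nonneg (‖P (n+1) x - P n x‖)]
        _ = ‖P M x‖^2 := hPn x M
        _ ≤ _ := by
          gcongr
          exact Submodule.norm_starProjection_apply_le _ _

end flag



section amp
variable {K : Type*} [NormedAddCommGroup K] [InnerProductSpace ℂ K] [CompleteSpace K]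

/-- Hilbert sum of countably many copies -/
abbrev SqS (K : Type*) [NormedAddCommGroup K] : Type _ := lp (fun _ : ℕ => K) 2

lemma SqS_hasSum (x : SqS K) : HasSum (fun j => ‖x j‖^2) (‖x‖^2) := by
  have := lp.hasSum_norm (p := 2) (by norm_num) x
  simpa using this

noncomputable def amp (X : K →L[ℂ] K) : SqS K →L[ℂ] SqS K :=
  lp.mapCLM 2 (fun _ : ℕ => X) (K := ‖X‖) (norm_nonneg _) (fun _ => le_rfl)

lemma amp_apply (X : K →L[ℂ] K) (x : SqS K) (j : ℕ) : amp X x j = X (x j) := rfl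

lemma amp_adjoint (X : K →L[ℂ] K) : adjoint (amp X) = amp (adjoint X) := by
  symm
  rw [ContinuousLinearMap.eq_adjoint_iff]
  intro x y
  rw [lp.inner_eq_tsum, lp.inner_eq_tsum]
  refine tsum_congr fun j => ?_
  rw [amp_apply, amp_apply, ContinuousLinearMap.adjoint_inner_left]

noncomputable def coordL (j : ℕ) : SqS K →L[ℂ] K := lp.evalCLM ℂ (fun _ : ℕ => K) 2 j

lemma coordL_apply (j : ℕ) (x : SqS K) : coordL j x = x j := rfl

lemma hasSum_pair_of_nonneg {F : ℕ × ℕ → ℝ} (h0 : ∀ p, 0 ≤ F p) {s : ℕ → ℝ} {S : ℝ}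
    (h1 : ∀ j, HasSum (fun k => F (j, k)) (s j)) (h2 : HasSum s S) : HasSum F S := by
  have hs : Summable F := by
    rw [summable_prod_of_nonneg h0]
    refine ⟨fun j => (h1 j).summable, ?_⟩
    simpa only [(h1 _).tsum_eq] using h2.summable
  have := hs.hasSum.prod_fiberwise h1
  rw [h2.unique this]
  exact hs.hasSum

theorem exists_amp_isometry {H E : Type*} [NormedAddCommGroup H] [InnerProductSpace ℂ H]
    [CompleteSpace H] [NormedAddCommGroup E] [InnerProductSpace ℂ E]
    [CompleteSpace E] [TopologicalSpace.SeparableSpace K]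
    {l : Filter ℕ} [NeBot l] (T : H →L[ℂ] H) (X : K →L[ℂ] K)
    (D : Submodule ℂ K) (hD : Dense (D : Set K)) (hDX : ∀ d ∈ D, X d ∈ D) (hDX' : ∀ d ∈ D, adjoint X d ∈ D)
    (V : ℕ → K →ₗ[ℂ] H)
    (hV : ∀ x ∈ D, ∀ y ∈ D, Tendsto (fun n => inner ℂ (V n x) (V n y)) l (𝓝 (inner ℂ x y)))
    (hw : ∀ x ∈ D, ∀ h, Tendsto (fun n => inner ℂ h (V n x)) l (𝓝 0))
    (hT : ∀ x ∈ D, Tendsto (fun n => T (V n x) - V n (X x)) l (𝓝 0))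
    (hT' : ∀ x ∈ D, Tendsto (fun n => adjoint T (V n x) - V n (adjoint X x)) l (𝓝 0))
    (A : E →L[ℂ] E) (q : ℕ → E →L[ℂ] K) (hq : ∀ x, HasSum (fun j => ‖q j x‖^2) (‖x‖^2))
    (hA : ∀ j, q j ∘L A = X ∘L q j) (hA' : ∀ j, q j ∘L adjoint A = adjoint X ∘L q j)
    (ε : ℝ) (hε : 0 < ε) :
    ∃ W : E →L[ℂ] H, adjoint W ∘L W = 1 ∧
      T ∘L W - W ∘L A ∈ Cpt E H ∧ ‖T ∘L W - W ∘L A‖ ≤ ε ∧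
      adjoint T ∘L W - W ∘L adjoint A ∈ Cpt E H ∧
      ‖adjoint T ∘L W - W ∘L adjoint A‖ ≤ ε := by
  have hpart := fun j : ℕ => exists_partition X D hD hDX hDX' (ε / 8 * (1/2)^j) (by positivity)
  choose f hf1 hf2 hf3 hf4 using hpart
  obtain ⟨e⟩ : Nonempty (ℕ ≃ ℕ × ℕ) := ⟨Nat.pairEquiv.symm⟩
  have hnc : ∀ j, ‖q j‖ ≤ 1 := by
    intro j
    refine ContinuousLinearMap.opNorm_le_bound _ zero_le_one fun x => ?_
    rw [one_mul]
    have := le_hasSum (hq x) j (fun _ _ => by positivity)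
    exact (sq_le_sq₀ (norm_nonneg _) (norm_nonneg _)).1 this
  have hδ : HasSum (fun p : ℕ × ℕ => ε / 8 * (1/2)^p.1 / 2^p.2) (ε/2) := by
    refine hasSum_pair_of_nonneg (s := fun j => ε / 8 * (1/2)^j * 2) (fun p => by positivity) ?_ ?_
    · intro j
      have := hasSum_geometric_two.mul_left (ε / 8 * (1/2)^j)
      have e : (fun k : ℕ => ε / 8 * (1/2)^j / 2^k) = fun k : ℕ => ε / 8 * (1/2)^j * (1/2)^k := by
        funext k; rw [div_eq_mul_inv, one_div, inv_pow, inv_pow]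
      exact e ▸ this
    · have := (hasSum_geometric_two.mul_left (ε / 8)).mul_right 2
      have e : ε / 8 * 2 * 2 = ε / 2 := by ring
      exact e ▸ this
  have key : ∀ j k, X ∘L (f j k ∘L q j) - (f j k ∘L q j) ∘L A
      = (X ∘L f j k - f j k ∘L X) ∘L q j := by
    intro j k
    rw [ContinuousLinearMap.sub_comp, ContinuousLinearMap.comp_assoc, ContinuousLinearMap.comp_assoc,
      ContinuousLinearMap.comp_assoc, hA]
  have key' : ∀ j k, adjoint X ∘L (f j k ∘L q j) - (f j k ∘L q j) ∘L adjoint A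
      = (adjoint X ∘L f j k - f j k ∘L adjoint X) ∘L q j := by
    intro j k
    rw [ContinuousLinearMap.sub_comp, ContinuousLinearMap.comp_assoc, ContinuousLinearMap.comp_assoc,
      ContinuousLinearMap.comp_assoc, hA']
  have key2 : ∀ (Y : K →L[ℂ] K) (j : ℕ) (c : ℝ), ‖Y‖ ≤ c → ‖Y ∘L q j‖ ≤ c := by
    intro Y j c hc
    refine (ContinuousLinearMap.opNorm_comp_le _ _).trans ?_
    have := mul_le_mul hc (hnc j) (norm_nonneg _) ((norm_nonneg _).trans hc)
    simpa using this
  have hk1 : ∀ j k, ‖X ∘L (f j k ∘L q j) - (f j k ∘L q j) ∘L A‖ ≤ ε / 8 * (1/2)^j / 2^k := by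
    intro j k
    rw [key]
    exact key2 _ _ _ (hf3 j k)
  have hk2 : ∀ j k, ‖adjoint X ∘L (f j k ∘L q j) - (f j k ∘L q j) ∘L adjoint A‖
      ≤ ε / 8 * (1/2)^j / 2^k := by
    intro j k
    rw [key']
    exact key2 _ _ _ (hf4 j k)
  have hps : ∀ x, HasSum (fun p : ℕ × ℕ => ‖(f p.1 p.2 ∘L q p.1) x‖^2) (‖x‖^2) := fun x =>
    hasSum_pair_of_nonneg (fun p => by positivity) (fun j => hf2 j (q j x)) (hq x)
  have hfr : ∀ j k, f j k ∘L q j ∈ FRD E D := fun j k => FRD_comp_right (hf1 _ _) _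
  generalize hdd : (fun p : ℕ × ℕ => ε / 8 * (1/2)^p.1 / 2^p.2) = δ at hδ
  generalize hgg : (fun p : ℕ × ℕ => f p.1 p.2 ∘L q p.1) = g
  have hk1' : ∀ p, ‖X ∘L g p - g p ∘L A‖ ≤ δ p := by
    intro p; rw [← hdd, ← hgg]; exact hk1 p.1 p.2
  have hk2' : ∀ p, ‖adjoint X ∘L g p - g p ∘L adjoint A‖ ≤ δ p := by
    intro p; rw [← hdd, ← hgg]; exact hk2 p.1 p.2
  have hps' : ∀ x, HasSum (fun p : ℕ × ℕ => ‖g p x‖^2) (‖x‖^2) := by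
    intro x; rw [← hgg]; exact hps x
  have hfr' : ∀ p, g p ∈ FRD E D := by
    intro p; rw [← hgg]; exact hfr p.1 p.2
  have := exists_isometry T X A D hDX hDX' V hV hw hT hT'
    (fun i => g (e i)) (fun i => hfr' (e i))
    (fun x => (e.hasSum_iff).2 (hps' x))
    (fun i => δ (e i)) (d := ε/2)
    ((e.hasSum_iff).2 hδ)
    (fun i => hk1' (e i)) (fun i => hk2' (e i)) (ε/2) (by positivity)
  rwa [add_halves] at this

noncomputable def headL : K →L[ℂ] SqS K :=
  lp.singleContinuousLinearMap ℂ (fun _ : ℕ => K) 2 0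

lemma headL_apply (x : K) (j : ℕ) : headL x j = if j = 0 then x else 0 := by
  rw [headL, lp.singleContinuousLinearMap_apply, lp.single_apply]
  simp [Pi.single_apply]

lemma shift_mem (x : SqS K) : Memℓp (fun j : ℕ => if j = 0 then (0:K) else x (j-1)) 2 := by
  apply memℓp_gen
  rw [← summable_nat_add_iff 1]
  have := (SqS_hasSum x).summable
  simpa using this

lemma shift_norm_sq (x : SqS K) (y : SqS K) (h0 : y 0 = 0) (h : ∀ j, y (j+1) = x j) :
    ‖y‖ = ‖x‖ := by
  have h1 := SqS_hasSum x
  have h2 := SqS_hasSum y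
  rw [← hasSum_nat_add_iff' 1] at h2
  simp only [h, Finset.range_one, Finset.sum_singleton, h0, norm_zero] at h2
  have := h1.unique h2
  have h3 : ‖x‖^2 = ‖y‖^2 := by simpa using this
  exact ((sq_eq_sq₀ (norm_nonneg _) (norm_nonneg _)).1 h3).symm

noncomputable def shiftL : SqS K →ₗᵢ[ℂ] SqS K where
  toFun x := ⟨fun j : ℕ => if j = 0 then (0:K) else x (j-1), shift_mem x⟩
  map_add' x y := by
    ext j
    change (if j = 0 then (0:K) else x (j-1) + y (j-1)) =
      (if j = 0 then (0:K) else x (j-1)) + (if j = 0 then (0:K) else y (j-1))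
    by_cases hj : j = 0 <;> simp [hj]
  map_smul' c x := by
    ext j; by_cases hj : j = 0 <;> simp [hj]
  norm_map' x := shift_norm_sq _ _ rfl (fun j => rfl)

lemma shiftL_zero (x : SqS K) : shiftL x 0 = 0 := rfl
lemma shiftL_succ (x : SqS K) (j : ℕ) : shiftL x (j+1) = x j := rfl

lemma exists_shift (X : K →L[ℂ] K) : ∃ (a : K →L[ℂ] SqS K) (b : SqS K →L[ℂ] SqS K),
    adjoint a ∘L a = 1 ∧ adjoint b ∘L b = 1 ∧ adjoint a ∘L b = 0 ∧ adjoint b ∘L a = 0 ∧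
    a ∘L adjoint a + b ∘L adjoint b = 1 ∧
    amp X ∘L a = a ∘L X ∧ amp X ∘L b = b ∘L amp X := by
  have ha : ∀ x : SqS K, adjoint (headL (K := K)) x = x 0 := by
    intro x
    refine ext_inner_left ℂ fun v => ?_
    rw [ContinuousLinearMap.adjoint_inner_right, headL, lp.singleContinuousLinearMap_apply,
      lp.inner_single_left]
  have hbe : ∀ x y : SqS K, y 0 = 0 → (∀ j, y (j+1) = x j) → y = shiftL x := by
    intro x y h0 h
    ext j
    cases j with
    | zero => rw [h0, shiftL_zero]
    | succ j => rw [h, shiftL_succ]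
  set b : SqS K →L[ℂ] SqS K := shiftL.toContinuousLinearMap with hb
  have hb1 : adjoint b ∘L b = 1 := by
    refine ContinuousLinearMap.ext fun x => ext_inner_left ℂ fun v => ?_
    rw [ContinuousLinearMap.comp_apply, ContinuousLinearMap.adjoint_inner_right]
    exact shiftL.inner_map_map v x
  have hab : adjoint (headL (K := K)) ∘L b = 0 := by
    ext x; rw [ContinuousLinearMap.comp_apply, ha]; rfl
  have hba : adjoint b ∘L headL = 0 := by
    have := congrArg adjoint hab
    simpa [adjoint_comp] using this
  have haa : adjoint (headL (K := K)) ∘L headL = 1 := by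
    ext x; rw [ContinuousLinearMap.comp_apply, ha, headL_apply]; simp
  refine ⟨headL, b, haa, hb1, hab, hba, ?_, ?_, ?_⟩
  · ext1 x
    have hm : Memℓp (fun j : ℕ => x (j+1)) 2 := by
      apply memℓp_gen
      have := (SqS_hasSum x).summable
      rw [← summable_nat_add_iff 1] at this
      simpa using this
    let y : SqS K := ⟨fun j : ℕ => x (j+1), hm⟩
    have hx : x = headL (x 0) + b y := by
      have : x - headL (x 0) = shiftL y := by
        refine hbe _ _ ?_ ?_
        · simp [headL_apply]
        · intro j; simp [headL_apply]; rfl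
      rw [hb]
      exact (eq_add_of_sub_eq' this)
    have e1 : adjoint headL x = x 0 := ha x
    have e2 : adjoint b x = y := by
      conv_lhs => rw [hx]
      rw [map_add]
      have := congrArg (fun A => A (x 0)) hba
      have h2 := congrArg (fun A => A y) hb1
      simp only [ContinuousLinearMap.comp_apply] at this h2
      rw [this, h2]; simp
    change headL (adjoint headL x) + b (adjoint b x) = x
    rw [e1, e2, ← hx]
  · ext x j
    simp only [ContinuousLinearMap.comp_apply, amp_apply, headL_apply]
    split_ifs <;> simp
  · ext x j
    change X (shiftL x j) = shiftL (amp X x) j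
    cases j with
    | zero => simp [shiftL_zero]
    | succ j => rw [shiftL_succ, shiftL_succ, amp_apply]


/-- the package needed later -/
lemma exists_package (X : K →L[ℂ] K) :
    ∃ (q : ℕ → SqS K →L[ℂ] K) (A : SqS K →L[ℂ] SqS K) (a : K →L[ℂ] SqS K)
    (b : SqS K →L[ℂ] SqS K), (∀ x, HasSum (fun j => ‖q j x‖^2) (‖x‖^2)) ∧
    (∀ j, q j ∘L A = X ∘L q j) ∧ (∀ j, q j ∘L adjoint A = adjoint X ∘L q j) ∧
    adjoint a ∘L a = 1 ∧ adjoint b ∘L b = 1 ∧ adjoint a ∘L b = 0 ∧ adjoint b ∘L a = 0 ∧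
    a ∘L adjoint a + b ∘L adjoint b = 1 ∧
    A ∘L a = a ∘L X ∧ A ∘L b = b ∘L A := by
  obtain ⟨a, b, h⟩ := exists_shift X
  refine ⟨coordL, amp X, a, b, SqS_hasSum, fun j => ?_, fun j => ?_, h⟩
  · ext x; rfl
  · rw [amp_adjoint]; ext x; rfl

end amp



section absorb
variable {H M K E : Type*} [NormedAddCommGroup H] [InnerProductSpace ℂ H] [CompleteSpace H]
  [NormedAddCommGroup M] [InnerProductSpace ℂ M] [CompleteSpace M]
  [NormedAddCommGroup K] [InnerProductSpace ℂ K] [CompleteSpace K]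
  [NormedAddCommGroup E] [InnerProductSpace ℂ E] [CompleteSpace E]

lemma pw {E F G : Type*} [NormedAddCommGroup E] [InnerProductSpace ℂ E]
    [NormedAddCommGroup F] [InnerProductSpace ℂ F]
    [NormedAddCommGroup G] [InnerProductSpace ℂ G] {A : F →L[ℂ] G} {B : E →L[ℂ] F}
    {C : E →L[ℂ] G} (h : A ∘L B = C) (x : E) : A (B x) = C x := by rw [← h]; rfl

lemma norm_le_one_of_adj {E F : Type*} [NormedAddCommGroup E] [InnerProductSpace ℂ E]
    [NormedAddCommGroup F] [InnerProductSpace ℂ F] [CompleteSpace E] [CompleteSpace F]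
    {A : E →L[ℂ] F} (h : adjoint A ∘L A = 1) : ‖A‖ ≤ 1 := by
  refine ContinuousLinearMap.opNorm_le_bound _ zero_le_one fun x => ?_
  rw [one_mul]
  exact ((ContinuousLinearMap.norm_map_iff_adjoint_comp_self A).2 h x).le

lemma norm_comp_le_of {E F G : Type*} [NormedAddCommGroup E] [InnerProductSpace ℂ E]
    [NormedAddCommGroup F] [InnerProductSpace ℂ F]
    [NormedAddCommGroup G] [InnerProductSpace ℂ G] {A : F →L[ℂ] G} {B : E →L[ℂ] F} {r s : ℝ}
    (hA : ‖A‖ ≤ r) (hB : ‖B‖ ≤ s) : ‖A ∘L B‖ ≤ r * s :=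
  (ContinuousLinearMap.opNorm_comp_le A B).trans
    (mul_le_mul hA hB (norm_nonneg _) ((norm_nonneg _).trans hA))

lemma absorb_alg (J : H →L[ℂ] M) (i : K →L[ℂ] M) (hJ : adjoint J ∘L J = 1)
    (hi : adjoint i ∘L i = 1) (hJi : adjoint J ∘L i = 0) (hiJ : adjoint i ∘L J = 0)
    (hs : J ∘L adjoint J + i ∘L adjoint i = 1)
    (a : K →L[ℂ] E) (b : E →L[ℂ] E) (ha : adjoint a ∘L a = 1) (hb : adjoint b ∘L b = 1)
    (hab : adjoint a ∘L b = 0) (hba : adjoint b ∘L a = 0)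
    (hsab : a ∘L adjoint a + b ∘L adjoint b = 1)
    (R : M →L[ℂ] M) (T : H →L[ℂ] H) (X : K →L[ℂ] K) (A : E →L[ℂ] E)
    (hAa : A ∘L a = a ∘L X) (hAb : A ∘L b = b ∘L A)
    (hRJ : adjoint J ∘L R = T ∘L adjoint J) (hRi : adjoint i ∘L R = X ∘L adjoint i)
    (V : E →L[ℂ] H) (hV : adjoint V ∘L V = 1) (ε : ℝ)
    (h1 : T ∘L V - V ∘L A ∈ Cpt E H) (h2 : ‖T ∘L V - V ∘L A‖ ≤ ε)
    (h3 : adjoint T ∘L V - V ∘L adjoint A ∈ Cpt E H)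
    (h4 : ‖adjoint T ∘L V - V ∘L adjoint A‖ ≤ ε) :
    ∃ U : M ≃L[ℂ] H, ‖(U : M →L[ℂ] H)‖ ≤ 1 ∧ ‖(U.symm : H →L[ℂ] M)‖ ≤ 1 ∧
      (U : M →L[ℂ] H) ∘L R - T ∘L (U : M →L[ℂ] H) ∈ Cpt M H ∧
      ‖(U : M →L[ℂ] H) ∘L R - T ∘L (U : M →L[ℂ] H)‖ ≤ 5 * ε := by
  set B : M →L[ℂ] E := a ∘L adjoint i + b ∘L (adjoint V ∘L adjoint J) with hB
  set U : M →L[ℂ] H := (adjoint J - V ∘L (adjoint V ∘L adjoint J)) + V ∘L B with hU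
  have hUa : adjoint U = (J - J ∘L V ∘L adjoint V) +
      ((i ∘L adjoint a) ∘L adjoint V + (J ∘L V ∘L adjoint b) ∘L adjoint V) := by
    simp only [hU, hB, map_add, map_sub, adjoint_comp, adjoint_adjoint,
      ContinuousLinearMap.add_comp, ContinuousLinearMap.comp_assoc]
  have hsabx : ∀ x, a (adjoint a x) = x - b (adjoint b x) := fun x => by
    have := congrArg (fun A => A x) hsab
    exact eq_sub_of_add_eq this
  have hsx : ∀ x, i (adjoint i x) = x - J (adjoint J x) := fun x => by
    have := congrArg (fun A => A x) hs
    exact eq_sub_of_add_eq' this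
  have hUU : U ∘L adjoint U = 1 := by
    rw [hUa, hU, hB]
    ext h
    simp [pw hJ, pw hi, pw hJi, pw hiJ, pw hV, hsabx]
  have hUU' : adjoint U ∘L U = 1 := by
    rw [hUa, hU, hB]
    ext h
    simp [pw ha, pw hb, pw hab, pw hba, pw hV, hsx]
  set C := T ∘L V - V ∘L A with hC
  set C' := adjoint (adjoint T ∘L V - V ∘L adjoint A) with hC'
  have hC'e : C' = adjoint V ∘L T - A ∘L adjoint V := by
    rw [hC']; simp [adjoint_comp]
  have hC'1 : C' ∈ Cpt H E := Cpt_adjoint h3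
  have hC'2 : ‖C'‖ ≤ ε := by rw [hC', LinearIsometryEquiv.norm_map]; exact h4
  have key : U ∘L R - T ∘L U = C ∘L (adjoint V ∘L adjoint J) - V ∘L (C' ∘L adjoint J) +
      V ∘L (b ∘L (C' ∘L adjoint J)) - C ∘L B := by
    rw [hC, hC'e, hU, hB]
    ext h
    simp only [ContinuousLinearMap.comp_apply, add_apply, sub_apply, map_add, map_sub,
      pw hRJ, pw hRi, pw hAa, pw hAb]
    abel
  have nJ := norm_le_one_of_adj hJ
  have nJ' : ‖adjoint J‖ ≤ 1 := by rwa [LinearIsometryEquiv.norm_map]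
  have ni' : ‖adjoint i‖ ≤ 1 := by rw [LinearIsometryEquiv.norm_map]; exact norm_le_one_of_adj hi
  have nV := norm_le_one_of_adj hV
  have nV' : ‖adjoint V‖ ≤ 1 := by rwa [LinearIsometryEquiv.norm_map]
  have na := norm_le_one_of_adj ha
  have nb := norm_le_one_of_adj hb
  have nB : ‖B‖ ≤ 2 := by
    refine (norm_add_le _ _).trans ?_
    have e1 := norm_comp_le_of na ni'
    have e2 := norm_comp_le_of nb (norm_comp_le_of nV' nJ')
    linarith
  have l : ∀ x, adjoint U (U x) = x := pw hUU'
  have r : ∀ x, U (adjoint U x) = x := pw hUU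
  let Ue : M ≃L[ℂ] H := ContinuousLinearEquiv.equivOfInverse U (adjoint U) l r
  have e1 : (Ue : M →L[ℂ] H) = U := by ext; rfl
  have e2 : (Ue.symm : H →L[ℂ] M) = adjoint U := by ext; rfl
  refine ⟨Ue, ?_, ?_, ?_, ?_⟩
  · rw [e1]; exact norm_le_one_of_adj hUU'
  · rw [e2, LinearIsometryEquiv.norm_map]; exact norm_le_one_of_adj hUU'
  · rw [e1, key]
    exact sub_mem (add_mem (sub_mem (Cpt_comp_right h1 _) (Cpt_comp_left (Cpt_comp_right hC'1 _) _))
      (Cpt_comp_left (Cpt_comp_left (Cpt_comp_right hC'1 _) _) _)) (Cpt_comp_right h1 _)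
  · rw [e1, key]
    have f1 := norm_comp_le_of h2 (norm_comp_le_of nV' nJ')
    have f2 := norm_comp_le_of nV (norm_comp_le_of hC'2 nJ')
    have f3 := norm_comp_le_of nV (norm_comp_le_of nb (norm_comp_le_of hC'2 nJ'))
    have f4 := norm_comp_le_of h2 nB
    refine (norm_sub_le _ _).trans ?_
    refine (add_le_add ((norm_add_le _ _).trans (add_le_add (norm_sub_le _ _) le_rfl)) le_rfl).trans ?_
    linarith


theorem absorption [TopologicalSpace.SeparableSpace M] {l : Filter ℕ} [NeBot l]
    (T : H →L[ℂ] H) (R : M →L[ℂ] M) (J : H →L[ℂ] M) (hJ : adjoint J ∘L J = 1)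
    (hRJ : R ∘L J = J ∘L T) (hRJ' : adjoint R ∘L J = J ∘L adjoint T)
    (D : Submodule ℂ M) (hD : Dense (D : Set M)) (hDR : ∀ d ∈ D, R d ∈ D)
    (hDR' : ∀ d ∈ D, adjoint R d ∈ D) (hJD : ∀ h, J h ∈ D)
    (V : ℕ → M →ₗ[ℂ] H)
    (hV : ∀ x ∈ D, ∀ y ∈ D, Tendsto (fun n => inner ℂ (V n x) (V n y)) l (𝓝 (inner ℂ x y)))
    (hw : ∀ x ∈ D, ∀ h, Tendsto (fun n => inner ℂ h (V n x)) l (𝓝 (inner ℂ (J h) x)))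
    (hT : ∀ x ∈ D, Tendsto (fun n => T (V n x) - V n (R x)) l (𝓝 0))
    (hT' : ∀ x ∈ D, Tendsto (fun n => adjoint T (V n x) - V n (adjoint R x)) l (𝓝 0))
    (ε : ℝ) (hε : 0 < ε) :
    ∃ U : M ≃L[ℂ] H, ‖(U : M →L[ℂ] H)‖ ≤ 1 ∧ ‖(U.symm : H →L[ℂ] M)‖ ≤ 1 ∧
      (U : M →L[ℂ] H) ∘L R - T ∘L (U : M →L[ℂ] H) ∈ Cpt M H ∧
      ‖(U : M →L[ℂ] H) ∘L R - T ∘L (U : M →L[ℂ] H)‖ ≤ ε := by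
  let N : Submodule ℂ M := LinearMap.ker (adjoint J : M →ₗ[ℂ] H)
  have hNm : ∀ x, x ∈ N ↔ adjoint J x = 0 := fun x => LinearMap.mem_ker
  have hNc : IsClosed (N : Set M) := ContinuousLinearMap.isClosed_ker (adjoint J)
  have : CompleteSpace N := hNc.completeSpace_coe
  have : TopologicalSpace.SeparableSpace N :=
    TopologicalSpace.SecondCountableTopology.to_separableSpace
  clear_value N
  set i : N →L[ℂ] M := N.subtypeL with hi0
  have hia : ∀ k : N, i k = (k : M) := fun k => rfl
  have hi : adjoint i ∘L i = 1 := by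
    refine ContinuousLinearMap.ext fun x => ext_inner_left ℂ fun v => ?_
    rw [ContinuousLinearMap.comp_apply, ContinuousLinearMap.adjoint_inner_right]
    rfl
  have hJi : adjoint J ∘L i = 0 := by
    ext k; exact (hNm _).1 k.2
  have hiJ : adjoint i ∘L J = 0 := by
    have := congrArg adjoint hJi
    simpa [adjoint_comp] using this
  have hii : ∀ x ∈ N, i (adjoint i x) = x := by
    intro x hx
    have : x = i ⟨x, hx⟩ := rfl
    rw [this, pw hi]; rfl
  have hs : J ∘L adjoint J + i ∘L adjoint i = 1 := by
    ext x
    have h1 : x - J (adjoint J x) ∈ N := by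
      rw [hNm, map_sub, pw hJ]; simp
    have h2 := hii _ h1
    rw [map_sub, pw hiJ] at h2
    simp only [zero_apply, sub_zero] at h2
    change J (adjoint J x) + i (adjoint i x) = x
    rw [h2]; abel
  have hJR : adjoint J ∘L R = T ∘L adjoint J := by
    have := congrArg adjoint hRJ'
    simpa [adjoint_comp] using this
  have hJR' : adjoint J ∘L adjoint R = adjoint T ∘L adjoint J := by
    have := congrArg adjoint hRJ
    simpa [adjoint_comp] using this
  set X : N →L[ℂ] N := adjoint i ∘L R ∘L i with hX
  have hXa : adjoint X = adjoint i ∘L adjoint R ∘L i := by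
    simp [hX, adjoint_comp, ContinuousLinearMap.comp_assoc]
  have hiX : ∀ k, i (X k) = R (i k) := by
    intro k
    refine hii _ ((hNm _).2 ?_)
    change adjoint J (R (i k)) = 0
    rw [pw hJR, ContinuousLinearMap.comp_apply, pw hJi]; simp
  have hiX' : ∀ k, i (adjoint X k) = adjoint R (i k) := by
    intro k
    rw [hXa]
    refine hii _ ((hNm _).2 ?_)
    change adjoint J (adjoint R (i k)) = 0
    rw [pw hJR', ContinuousLinearMap.comp_apply, pw hJi]; simp
  have hRi : adjoint i ∘L R = X ∘L adjoint i := by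
    have h1 : i ∘L adjoint X = adjoint R ∘L i := ContinuousLinearMap.ext hiX'
    have := congrArg adjoint h1
    simpa [adjoint_comp] using this.symm
  let DK : Submodule ℂ N := D.comap (i : N →ₗ[ℂ] M)
  have hDKm : ∀ k, k ∈ DK ↔ i k ∈ D := fun k => Iff.rfl
  have hDK : Dense (DK : Set N) := by
    have hsur : Function.Surjective (adjoint i) := fun k => ⟨i k, pw hi k⟩
    have := hsur.denseRange.dense_image (adjoint i).continuous hD
    refine this.mono ?_
    rintro _ ⟨d, hd, rfl⟩
    change i (adjoint i d) ∈ D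
    have h3 : i (adjoint i d) = d - J (adjoint J d) :=
      eq_sub_of_add_eq' (congrArg (fun A => A d) hs)
    rw [h3]
    exact D.sub_mem hd (hJD _)
  obtain ⟨q, A, a, b, hq, hqA, hqA', ha, hb, hab, hba, hsab, hAa, hAb⟩ := exists_package X
  obtain ⟨W, hW, c1, c2, c3, c4⟩ := exists_amp_isometry (l := l) T X DK hDK
    (fun d hd => by rw [hDKm, hiX]; exact hDR _ hd)
    (fun d hd => by rw [hDKm, hiX']; exact hDR' _ hd)
    (fun n => (V n) ∘ₗ (i : N →ₗ[ℂ] M))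
    (fun x hx y hy => hV (i x) hx (i y) hy)
    (fun x hx h => by
      have := hw (i x) hx h
      rw [← ContinuousLinearMap.adjoint_inner_right, pw hJi] at this
      simpa using this)
    (fun x hx => by
      have := hT (i x) hx
      simp only [← hiX] at this
      exact this)
    (fun x hx => by
      have := hT' (i x) hx
      simp only [← hiX'] at this
      exact this)
    A q hq hqA hqA' (ε/5) (by positivity)
  obtain ⟨U, u1, u2, u3, u4⟩ := absorb_alg J i hJ hi hJi hiJ hs a b ha hb hab hba hsab R T X A hAa hAb
    hJR hRi W hW (ε/5) c1 c2 c3 c4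
  exact ⟨U, u1, u2, u3, u4.trans (by linarith)⟩

end absorb



section model
universe u

lemma exists_gns {W : Type u} [AddCommGroup W] [Module ℂ W] (B : W → W → ℂ)
    (h1 : ∀ x y, (starRingEnd ℂ) (B y x) = B x y) (h2 : ∀ x, 0 ≤ RCLike.re (B x x))
    (h3 : ∀ x y z, B (x + y) z = B x z + B y z)
    (h4 : ∀ x y (r : ℂ), B (r • x) y = (starRingEnd ℂ) r * B x y) :
    ∃ (M : Type u) (_ : NormedAddCommGroup M) (_ : InnerProductSpace ℂ M) (_ : CompleteSpace M)
      (q : W →ₗ[ℂ] M), DenseRange q ∧ ∀ x y, inner ℂ (q x) (q y) = B x y := by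
  let c : PreInnerProductSpace.Core ℂ W :=
    { inner := B, conj_inner_symm := h1, re_inner_nonneg := h2, add_left := h3, smul_left := h4 }
  letI : SeminormedAddCommGroup W := @InnerProductSpace.Core.toSeminormedAddCommGroup ℂ W _ _ _ c
  letI : InnerProductSpace ℂ W := InnerProductSpace.ofCore c
  refine ⟨UniformSpace.Completion W, inferInstance, inferInstance, inferInstance,
    (UniformSpace.Completion.toComplL : W →L[ℂ] UniformSpace.Completion W), ?_, ?_⟩
  · exact UniformSpace.Completion.denseRange_coe
  · intro x y
    exact UniformSpace.Completion.inner_coe x y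

variable {H : Type u} [NormedAddCommGroup H] [InnerProductSpace ℂ H] [CompleteSpace H]

lemma exists_ultra (𝒰 : Ultrafilter ℕ) (W : Submodule ℂ (ℕ → H))
    (hW : ∀ x ∈ W, ∃ C : ℝ, ∀ n, ‖x n‖ ≤ C) :
    ∃ (M : Type u) (_ : NormedAddCommGroup M) (_ : InnerProductSpace ℂ M) (_ : CompleteSpace M)
      (q : W →ₗ[ℂ] M), DenseRange q ∧ ∀ x y : W,
        Tendsto (fun n => inner ℂ ((x : ℕ → H) n) ((y : ℕ → H) n)) 𝒰 (𝓝 (inner ℂ (q x) (q y))) := by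
  have hlim : ∀ x y : W, ∃ z : ℂ,
      Tendsto (fun n => inner ℂ ((x : ℕ → H) n) ((y : ℕ → H) n)) 𝒰 (𝓝 z) := by
    intro x y
    obtain ⟨C, hC⟩ := hW x x.2
    obtain ⟨C', hC'⟩ := hW y y.2
    have hc : IsCompact (Metric.closedBall (0:ℂ) (C * C')) := isCompact_closedBall _ _
    obtain ⟨z, _, hz⟩ := hc.ultrafilter_le_nhds
      (𝒰.map (fun n => inner ℂ ((x : ℕ → H) n) ((y : ℕ → H) n))) (by
        rw [le_principal_iff, Ultrafilter.mem_coe, Ultrafilter.mem_map]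
        refine Filter.univ_mem' fun n => ?_
        simp only [Set.mem_preimage, mem_closedBall_zero_iff]
        refine (norm_inner_le_norm _ _).trans ?_
        exact mul_le_mul (hC n) (hC' n) (norm_nonneg _) ((norm_nonneg _).trans (hC n)))
    exact ⟨z, hz⟩
  choose B hB using hlim
  obtain ⟨M, i1, i2, i3, q, hq, hqB⟩ := exists_gns B
    (fun x y => by
      have h1 := (Complex.continuous_conj.tendsto _).comp (hB y x)
      refine tendsto_nhds_unique h1 ?_
      refine (hB x y).congr fun n => ?_
      simp)
    (fun x => by
      have h1 := (Complex.continuous_re.tendsto _).comp (hB x x)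
      refine ge_of_tendsto' h1 fun n => ?_
      exact inner_self_nonneg (𝕜 := ℂ))
    (fun x y z => by
      refine tendsto_nhds_unique (hB (x+y) z) (((hB x z).add (hB y z)).congr fun n => ?_)
      simp [inner_add_left])
    (fun x y r => by
      refine tendsto_nhds_unique (hB (r • x) y) (((hB x y).const_mul _).congr fun n => ?_)
      simp [inner_smul_left, mul_comm])
  refine ⟨M, i1, i2, i3, q, hq, fun x y => ?_⟩
  rw [hqB]; exact hB x y

lemma exists_words [TopologicalSpace.SeparableSpace H] {ι : Type} [Countable ι]
    (A : ι → ℕ → H →L[ℂ] H) (c : ι → ℝ) (hc : ∀ i n, ‖A i n‖ ≤ c i) :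
    ∃ W : Submodule ℂ (ℕ → H), (∀ h, (fun _ => h) ∈ W) ∧
      (∀ i, ∀ x ∈ W, (fun n => A i n (x n)) ∈ W) ∧
      (∀ x ∈ W, ∃ C : ℝ, ∀ n, ‖x n‖ ≤ C) ∧
      ∃ (w : List ι → H →ₗ[ℂ] W) (C : List ι → ℝ),
        (∀ s h n, ‖(w s h : ℕ → H) n‖ ≤ C s * ‖h‖) ∧
        ∀ x : W, x ∈ Submodule.span ℂ (⋃ s, Set.range (w s)) := by
  let L : ι → (ℕ → H) →ₗ[ℂ] (ℕ → H) := fun i =>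
    { toFun := fun x n => A i n (x n)
      map_add' := fun x y => by ext n; simp
      map_smul' := fun r x => by ext n; simp }
  let k : H →ₗ[ℂ] (ℕ → H) :=
    { toFun := fun h _ => h, map_add' := fun x y => rfl, map_smul' := fun r x => rfl }
  let w : List ι → H →ₗ[ℂ] (ℕ → H) := fun s => s.foldr (fun i f => L i ∘ₗ f) k
  have hw0 : w [] = k := rfl
  have hw1 : ∀ i s, w (i :: s) = L i ∘ₗ w s := fun i s => rfl
  let C : List ι → ℝ := fun s => s.foldr (fun i r => c i * r) 1
  have hC0 : ∀ s, 0 ≤ C s := by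
    intro s
    induction s with
    | nil => exact zero_le_one
    | cons i s ih => exact mul_nonneg ((norm_nonneg _).trans (hc i 0)) ih
  have hC : ∀ s h n, ‖w s h n‖ ≤ C s * ‖h‖ := by
    intro s h n
    induction s with
    | nil => change ‖h‖ ≤ 1 * ‖h‖; simp
    | cons i s ih =>
      change ‖A i n (w s h n)‖ ≤ (c i * C s) * ‖h‖
      rw [mul_assoc]
      exact ((A i n).le_opNorm _).trans (mul_le_mul (hc i n) ih (norm_nonneg _)
        ((norm_nonneg _).trans (hc i n)))
  let W : Submodule ℂ (ℕ → H) := Submodule.span ℂ (⋃ s, Set.range (w s))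
  have hwW : ∀ s h, w s h ∈ W := fun s h => Submodule.subset_span
    (Set.mem_iUnion.2 ⟨s, ⟨h, rfl⟩⟩)
  refine ⟨W, fun h => hwW [] h, ?_, ?_, fun s => (w s).codRestrict W (hwW s), C, hC, ?_⟩
  · intro i x hx
    change L i x ∈ W
    induction hx using Submodule.span_induction with
    | mem x hx =>
      obtain ⟨s, h, rfl⟩ := Set.mem_iUnion.1 hx
      exact hwW (i :: s) h
    | zero => rw [map_zero]; exact zero_mem _
    | add x y _ _ hx hy => rw [map_add]; exact add_mem hx hy
    | smul r x _ hx => rw [map_smul]; exact Submodule.smul_mem _ _ hx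
  · intro x hx
    induction hx using Submodule.span_induction with
    | mem x hx =>
      obtain ⟨s, h, rfl⟩ := Set.mem_iUnion.1 hx
      exact ⟨_, hC s h⟩
    | zero => exact ⟨0, fun n => by simp⟩
    | add x y _ _ hx hy =>
      obtain ⟨a, ha⟩ := hx
      obtain ⟨b, hb⟩ := hy
      exact ⟨a + b, fun n => (norm_add_le _ _).trans (add_le_add (ha n) (hb n))⟩
    | smul r x _ hx =>
      obtain ⟨a, ha⟩ := hx
      refine ⟨‖r‖ * a, fun n => ?_⟩
      rw [Pi.smul_apply, norm_smul]
      exact mul_le_mul_of_nonneg_left (ha n) (norm_nonneg _)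
  · rintro ⟨x, hx⟩
    induction hx using Submodule.span_induction with
    | mem x hx =>
      obtain ⟨s, h, rfl⟩ := Set.mem_iUnion.1 hx
      exact Submodule.subset_span (Set.mem_iUnion.2 ⟨s, ⟨h, rfl⟩⟩)
    | zero => exact zero_mem _
    | add x y hx' hy' hx hy => exact add_mem hx hy
    | smul r x _ hx => exact Submodule.smul_mem _ r hx

lemma exists_model [TopologicalSpace.SeparableSpace H] {ι : Type} [Countable ι]
    (𝒰 : Ultrafilter ℕ) (h𝒰 : (𝒰 : Filter ℕ) ≤ atTop)
    (A : ι → ℕ → H →L[ℂ] H) (c : ι → ℝ) (hc : ∀ i n, ‖A i n‖ ≤ c i) :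
    ∃ (M : Type u) (_ : NormedAddCommGroup M) (_ : InnerProductSpace ℂ M) (_ : CompleteSpace M)
      (_ : TopologicalSpace.SeparableSpace M) (J : H →L[ℂ] M) (R : ι → M →L[ℂ] M)
      (D : Submodule ℂ M) (V : ℕ → M →ₗ[ℂ] H),
      adjoint J ∘L J = 1 ∧ Dense (D : Set M) ∧ (∀ i, ∀ d ∈ D, R i d ∈ D) ∧ (∀ h, J h ∈ D) ∧
      (∀ x ∈ D, ∀ y ∈ D, Tendsto (fun n => inner ℂ (V n x) (V n y)) 𝒰 (𝓝 (inner ℂ x y))) ∧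
      (∀ x ∈ D, ∀ h, Tendsto (fun n => inner ℂ h (V n x)) 𝒰 (𝓝 (inner ℂ (J h) x))) ∧
      (∀ i, ‖R i‖ ≤ c i) ∧
      (∀ i, ∀ x ∈ D, Tendsto (fun n => A i n (V n x) - V n (R i x)) 𝒰 (𝓝 0)) ∧
      (∀ i j, (∀ n, A j n = adjoint (A i n)) → R j = adjoint (R i)) ∧
      (∀ i T, (∀ n, A i n = T) → R i ∘L J = J ∘L T) ∧
      (∀ i j, (∀ n, A i n ∘L A j n = 1) → R i ∘L R j = 1) ∧
      (∀ i j k m, Tendsto (fun n => ‖A i n - A j n ∘L A k n ∘L A m n‖) atTop (𝓝 0) →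
        R i = R j ∘L R k ∘L R m) := by
  obtain ⟨W, hWc, hWi, hWb, w, C, hwC, hwspan⟩ := exists_words A c hc
  obtain ⟨M, i1, i2, i3, q, hq, hin⟩ := exists_ultra 𝒰 W hWb
  have hnorm : ∀ x : W, Tendsto (fun n => ‖(x : ℕ → H) n‖) 𝒰 (𝓝 ‖q x‖) := by
    intro x
    have h1 := (Real.continuous_sqrt.tendsto _).comp ((Complex.continuous_re.tendsto _).comp (hin x x))
    have e : ∀ {E : Type u} [NormedAddCommGroup E] [InnerProductSpace ℂ E] (v : E),
        Real.sqrt (inner ℂ v v : ℂ).re = ‖v‖ := by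
      intro E _ _ v
      have := norm_eq_sqrt_re_inner (𝕜 := ℂ) v
      exact this.symm
    rw [e] at h1
    refine h1.congr fun n => ?_
    simp only [Function.comp]
    exact e _
  have hle : ∀ (x : W) (r : ℝ), (∀ n, ‖(x : ℕ → H) n‖ ≤ r) → ‖q x‖ ≤ r := fun x r h =>
    le_of_tendsto' (hnorm x) h
  have hq0 : ∀ x : W, Tendsto (fun n => (x : ℕ → H) n) 𝒰 (𝓝 0) → q x = 0 := by
    intro x h
    have h1 := tendsto_nhds_unique (hnorm x) h.norm
    rw [norm_zero] at h1
    exact norm_eq_zero.1 h1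
  have hq0' : ∀ x : W, q x = 0 → Tendsto (fun n => (x : ℕ → H) n) 𝒰 (𝓝 0) := by
    intro x h
    have h1 := hnorm x
    rw [h, norm_zero] at h1
    exact tendsto_zero_iff_norm_tendsto_zero.2 h1
  let L : ι → W →ₗ[ℂ] W := fun i =>
    { toFun := fun x => ⟨fun n => A i n ((x : ℕ → H) n), hWi i x x.2⟩
      map_add' := fun x y => by ext n; simp
      map_smul' := fun r x => by ext n; simp }
  have hL : ∀ i x n, (L i x : ℕ → H) n = A i n ((x : ℕ → H) n) := fun i x n => rfl
  have hLn : ∀ i x, ‖(q ∘ₗ L i) x‖ ≤ c i * ‖q x‖ := by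
    intro i x
    refine le_of_tendsto_of_tendsto' (hnorm (L i x)) ((hnorm x).const_mul (c i)) fun n => ?_
    exact ((A i n).le_opNorm _).trans (mul_le_mul_of_nonneg_right (hc i n) (norm_nonneg _))
  have hc0 : ∀ i, 0 ≤ c i := fun i => (norm_nonneg _).trans (hc i 0)
  let R : ι → M →L[ℂ] M := fun i => (q ∘ₗ L i).extendOfNorm q
  have hR : ∀ i x, R i (q x) = q (L i x) := fun i x =>
    LinearMap.extendOfNorm_eq hq ⟨c i, hLn i⟩ x
  let k : H →ₗ[ℂ] W :=
    { toFun := fun h => ⟨fun _ => h, hWc h⟩, map_add' := fun x y => rfl, map_smul' := fun r x => rfl }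
  have hk : ∀ h n, (k h : ℕ → H) n = h := fun h n => rfl
  let J : H →L[ℂ] M := (q ∘ₗ k).mkContinuous 1 (fun h => by
    rw [one_mul]; exact hle (k h) _ fun n => le_rfl)
  have hJ : ∀ h, J h = q (k h) := fun h => rfl
  obtain ⟨σ, hσ⟩ := LinearMap.exists_rightInverse_of_surjective q.rangeRestrict
    (LinearMap.range_rangeRestrict q)
  have hσ' : ∀ x : LinearMap.range q, q (σ x) = x := fun x => by
    have := LinearMap.congr_fun hσ x
    exact congrArg Subtype.val this
  have hVe : ∀ n, ∃ g : M →ₗ[ℂ] H, g ∘ₗ (LinearMap.range q).subtype =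
      (LinearMap.proj n ∘ₗ W.subtype) ∘ₗ σ := fun n => LinearMap.exists_extend _
  choose V hV using hVe
  have hV' : ∀ n (x : LinearMap.range q), V n x = (σ x : ℕ → H) n := fun n x =>
    LinearMap.congr_fun (hV n) x
  have hD : Dense ((LinearMap.range q : Submodule ℂ M) : Set M) := hq
  have hext : ∀ P Q : M →L[ℂ] M, (∀ x, P (q x) = Q (q x)) → P = Q := by
    intro P Q h
    ext z
    exact congrFun (hq.equalizer P.continuous Q.continuous (funext h)) z
  have hsep : TopologicalSpace.SeparableSpace M := by
    have h1 : ∀ s, TopologicalSpace.IsSeparable (Set.range fun h => q (w s h)) := by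
      intro s
      let f : H →L[ℂ] M := (q ∘ₗ w s).mkContinuous (C s) (fun h => hle _ _ (hwC s h))
      exact TopologicalSpace.isSeparable_range f.continuous
    have h2 : TopologicalSpace.IsSeparable (⋃ s, Set.range fun h => q (w s h)) :=
      TopologicalSpace.IsSeparable.iUnion h1
    have h3 := (TopologicalSpace.IsSeparable.span (R := ℂ) h2).closure
    rw [← TopologicalSpace.isSeparable_univ_iff]
    refine h3.mono fun z _ => ?_
    refine closure_mono ?_ (hD z)
    rintro _ ⟨x, rfl⟩
    have h4 := Submodule.mem_map_of_mem (f := q) (hwspan x)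
    rw [Submodule.map_span, Set.image_iUnion] at h4
    have h5 : (⋃ s, q '' Set.range (w s)) = ⋃ s, Set.range fun h => q (w s h) :=
      Set.iUnion_congr fun s => by rw [← Set.range_comp]; rfl
    rw [h5] at h4
    exact h4
  refine ⟨M, i1, i2, i3, hsep, J, R, LinearMap.range q, V, ?_, hD, ?_, ?_, ?_, ?_, ?_, ?_, ?_, ?_,
    ?_, ?_⟩
  · ext h
    refine ext_inner_left ℂ fun v => ?_
    rw [comp_apply, adjoint_inner_right, hJ, hJ]
    exact tendsto_nhds_unique (hin (k v) (k h)) tendsto_const_nhds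
  · rintro i _ ⟨x, rfl⟩
    exact ⟨L i x, (hR i x).symm⟩
  · exact fun h => ⟨k h, rfl⟩
  · intro x hx y hy
    have h1 := hin (σ ⟨x, hx⟩) (σ ⟨y, hy⟩)
    rw [hσ', hσ'] at h1
    refine h1.congr fun n => ?_
    rw [← hV', ← hV']
  · intro x hx h
    have h1 := hin (k h) (σ ⟨x, hx⟩)
    rw [hσ'] at h1
    refine h1.congr fun n => ?_
    rw [← hV', hk]
  · exact fun i => LinearMap.opNorm_extendOfNorm_le hq (hc0 i) (hLn i)
  · intro i x hx
    have hx' : R i x ∈ LinearMap.range q := ⟨L i (σ ⟨x, hx⟩), by rw [← hR, hσ']⟩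
    have h1 : q (L i (σ ⟨x, hx⟩) - σ ⟨R i x, hx'⟩) = 0 := by
      rw [map_sub, ← hR, hσ', hσ', sub_self]
    refine (hq0' _ h1).congr fun n => ?_
    rw [hV' n ⟨x, hx⟩, hV' n ⟨R i x, hx'⟩]
    rfl
  · intro i j hij
    have h1 : ∀ x y, inner ℂ (R j (q x)) (q y) = inner ℂ (adjoint (R i) (q x)) (q y) := by
      intro x y
      rw [adjoint_inner_left, hR, hR]
      refine tendsto_nhds_unique (hin (L j x) y) ((hin x (L i y)).congr fun n => ?_)
      rw [hL, hL, hij, adjoint_inner_left]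
    refine hext _ _ fun x => ?_
    refine ext_inner_right ℂ fun z => ?_
    have e1 : Continuous fun z : M => (inner ℂ (R j (q x)) z : ℂ) := by fun_prop
    have e2 : Continuous fun z : M => (inner ℂ (adjoint (R i) (q x)) z : ℂ) := by fun_prop
    exact congrFun (hq.equalizer e1 e2 (funext (h1 x))) z
  · intro i T h
    ext v
    rw [comp_apply, comp_apply, hJ, hJ, hR]
    congr 1
    ext n
    rw [hL, h, hk, hk]
  · intro i j h
    refine hext _ _ fun x => ?_
    rw [comp_apply, hR, hR]
    change q _ = q x
    congr 1
    ext n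
    rw [hL, hL]
    exact pw (h n) _
  · intro i j k m h
    refine hext _ _ fun x => ?_
    rw [comp_apply, comp_apply, hR, hR, hR, hR, ← sub_eq_zero, ← map_sub]
    apply hq0
    obtain ⟨r, hr⟩ := hWb x x.2
    have h1 := (h.mono_left h𝒰).mul_const r
    rw [zero_mul] at h1
    refine squeeze_zero_norm (fun n => ?_) h1
    have h2 : (((L i x - L j (L k (L m x)) : W)) : ℕ → H) n =
      (A i n - A j n ∘L A k n ∘L A m n) ((x : ℕ → H) n) := rfl
    rw [h2]
    exact ((A i n - A j n ∘L A k n ∘L A m n).le_opNorm _).trans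
      (mul_le_mul_of_nonneg_left (hr n) (norm_nonneg _))

end model



section final
universe u
variable {H : Type u} [NormedAddCommGroup H] [InnerProductSpace ℂ H] [CompleteSpace H]

lemma exists_seq [Nontrivial H] (T₁ T₂ : H →L[ℂ] H) (lam : ℝ)
    (h : T₂ ∈ closure {A | ∃ S : H ≃L[ℂ] H, ‖(S : H →L[ℂ] H)‖ * ‖(S.symm : H →L[ℂ] H)‖ ≤ lam ∧
    A = ((S : H →L[ℂ] H).comp T₁).comp (S.symm : H →L[ℂ] H)}) :
    ∃ P Q : ℕ → H →L[ℂ] H, (∀ n, ‖P n‖ ≤ lam) ∧ (∀ n, ‖Q n‖ ≤ 1) ∧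
      (∀ n, P n ∘L Q n = 1) ∧ (∀ n, Q n ∘L P n = 1) ∧
      Tendsto (fun n => ‖T₂ - P n ∘L T₁ ∘L Q n‖) atTop (𝓝 0) := by
  have key : ∀ n : ℕ, ∃ P Q : H →L[ℂ] H, ‖P‖ ≤ lam ∧ ‖Q‖ ≤ 1 ∧ P ∘L Q = 1 ∧ Q ∘L P = 1 ∧
      ‖T₂ - P ∘L T₁ ∘L Q‖ ≤ 1 / ((n : ℝ) + 1) := by
    intro n
    obtain ⟨A, ⟨S, hS, rfl⟩, hA⟩ := Metric.mem_closure_iff.1 h (1 / ((n : ℝ) + 1)) (by positivity)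
    rw [dist_eq_norm] at hA
    set r : ℝ := ‖(S.symm : H →L[ℂ] H)‖ with hr
    have hr0 : 0 < r := by
      rw [hr, norm_pos_iff]
      intro h0
      obtain ⟨x, hx⟩ := exists_ne (0 : H)
      apply hx
      have : S.symm (S x) = 0 := by
        have := congrArg (fun B : H →L[ℂ] H => B (S x)) h0
        simpa using this
      simpa using this
    obtain ⟨z, hz⟩ : ∃ z : ℂ, ‖z‖ = r :=
      ⟨(r : ℂ), by rw [Complex.norm_real, Real.norm_of_nonneg hr0.le]⟩
    have hrc : z ≠ 0 := by rw [← norm_pos_iff, hz]; exact hr0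
    refine ⟨z • (S : H →L[ℂ] H), z⁻¹ • (S.symm : H →L[ℂ] H), ?_, ?_, ?_, ?_, ?_⟩
    · rw [norm_smul, hz, mul_comm]; exact hS
    · rw [norm_smul, norm_inv, hz, ← hr,
        inv_mul_cancel₀ hr0.ne']
    · ext x; simp [smul_smul, hrc]
    · ext x; simp [smul_smul, hrc]
    · refine le_trans (le_of_eq ?_) hA.le
      congr 2
      ext x; simp [smul_smul, hrc]
  choose P Q h1 h2 h3 h4 h5 using key
  exact ⟨P, Q, h1, h2, h3, h4, squeeze_zero (fun n => norm_nonneg _) h5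
    tendsto_one_div_add_atTop_nhds_zero_nat⟩

lemma final_step [TopologicalSpace.SeparableSpace H] (T₁ T₂ : H →L[ℂ] H) (lam : ℝ)
    (hlam : 1 ≤ lam) (P Q : ℕ → H →L[ℂ] H) (hP : ∀ n, ‖P n‖ ≤ lam) (hQ : ∀ n, ‖Q n‖ ≤ 1)
    (hPQ : ∀ n, P n ∘L Q n = 1) (hQP : ∀ n, Q n ∘L P n = 1)
    (hlim : Tendsto (fun n => ‖T₂ - P n ∘L T₁ ∘L Q n‖) atTop (𝓝 0)) (ε : ℝ) (hε : 0 < ε) :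
    ∃ S : H ≃L[ℂ] H, ‖(S : H →L[ℂ] H)‖ * ‖(S.symm : H →L[ℂ] H)‖ ≤ lam ∧
      ‖T₂ - ((S : H →L[ℂ] H).comp T₁).comp (S.symm : H →L[ℂ] H)‖ ≤ lam * ε + ε ∧
      IsCompactOperator (T₂ - ((S : H →L[ℂ] H).comp T₁).comp (S.symm : H →L[ℂ] H)) := by
  let A : Fin 6 → ℕ → H →L[ℂ] H := ![fun _ => T₁, fun _ => adjoint T₁, fun _ => T₂,
    fun _ => adjoint T₂, P, Q]
  let c : Fin 6 → ℝ := ![‖T₁‖, ‖adjoint T₁‖, ‖T₂‖, ‖adjoint T₂‖, lam, 1]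
  have hc : ∀ i n, ‖A i n‖ ≤ c i := by
    intro i n
    fin_cases i
    · exact le_rfl
    · exact le_rfl
    · exact le_rfl
    · exact le_rfl
    · exact hP n
    · exact hQ n
  obtain ⟨M, i1, i2, i3, i4, J, R, D, V, hJ, hD, hDR, hJD, hV, hw, hRn, hT, hadj, hconst, hone,
    hsim⟩ := exists_model (hyperfilter ℕ) Nat.hyperfilter_le_atTop A c hc
  have a1 : R 1 = adjoint (R 0) := hadj 0 1 fun n => rfl
  have a2 : R 3 = adjoint (R 2) := hadj 2 3 fun n => rfl
  have c0 : R 0 ∘L J = J ∘L T₁ := hconst 0 _ fun n => rfl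
  have c1 : R 1 ∘L J = J ∘L adjoint T₁ := hconst 1 _ fun n => rfl
  have c2 : R 2 ∘L J = J ∘L T₂ := hconst 2 _ fun n => rfl
  have c3 : R 3 ∘L J = J ∘L adjoint T₂ := hconst 3 _ fun n => rfl
  have o1 : R 4 ∘L R 5 = 1 := hone 4 5 hPQ
  have o2 : R 5 ∘L R 4 = 1 := hone 5 4 hQP
  have s1 : R 2 = R 4 ∘L R 0 ∘L R 5 := hsim 2 4 0 5 hlim
  have n4 : ‖R 4‖ ≤ lam := hRn 4
  have n5 : ‖R 5‖ ≤ 1 := hRn 5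
  have d1 := hDR 1
  have d3 := hDR 3
  have t1 := hT 1
  have t3 := hT 3
  rw [a1] at c1 d1 t1
  rw [a2] at c3 d3 t3
  obtain ⟨U, hU1, hU2, hU3, hU4⟩ := absorption T₁ (R 0) J hJ c0 c1 D hD (hDR 0) d1 hJD V hV hw
    (hT 0) t1 ε hε
  obtain ⟨Z, hZ1, hZ2, hZ3, hZ4⟩ := absorption T₂ (R 2) J hJ c2 c3 D hD (hDR 2) d3 hJD V hV hw
    (hT 2) t3 ε hε
  let S' : M ≃L[ℂ] M := ContinuousLinearEquiv.equivOfInverse (R 4) (R 5)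
    (fun x => pw o2 x) (fun x => pw o1 x)
  let S : H ≃L[ℂ] H := (U.symm.trans S').trans Z
  have eS : (S : H →L[ℂ] H) = (Z : M →L[ℂ] H) ∘L (R 4 ∘L (U.symm : H →L[ℂ] M)) := rfl
  have eS' : (S.symm : H →L[ℂ] H) = (U : M →L[ℂ] H) ∘L (R 5 ∘L (Z.symm : H →L[ℂ] M)) := rfl
  have nS : ‖(S : H →L[ℂ] H)‖ ≤ 1 * (lam * 1) := by
    rw [eS]; exact norm_comp_le_of hZ1 (norm_comp_le_of n4 hU2)
  have nS' : ‖(S.symm : H →L[ℂ] H)‖ ≤ 1 * (1 * 1) := by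
    rw [eS']; exact norm_comp_le_of hU1 (norm_comp_le_of n5 hZ2)
  have n5Z : ‖R 5 ∘L (Z.symm : H →L[ℂ] M)‖ ≤ 1 * 1 := norm_comp_le_of n5 hZ2
  have main : T₂ - ((S : H →L[ℂ] H).comp T₁).comp (S.symm : H →L[ℂ] H) =
      (S : H →L[ℂ] H) ∘L (((U : M →L[ℂ] H) ∘L R 0 - T₁ ∘L (U : M →L[ℂ] H)) ∘L
        (R 5 ∘L (Z.symm : H →L[ℂ] M)))
      - ((Z : M →L[ℂ] H) ∘L R 2 - T₂ ∘L (Z : M →L[ℂ] H)) ∘L (Z.symm : H →L[ℂ] M) := by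
    ext x
    have e : R 2 (Z.symm x) = R 4 (R 0 (R 5 (Z.symm x))) := by rw [s1]; rfl
    simp [eS, eS', e]
  refine ⟨S, ?_, ?_, ?_⟩
  · calc _ ≤ (1 * (lam * 1)) * (1 * (1 * 1)) :=
        mul_le_mul nS nS' (norm_nonneg _) (by linarith)
      _ = lam := by ring
  · rw [main]
    refine (norm_sub_le _ _).trans (add_le_add ?_ ?_)
    · refine (norm_comp_le_of nS (norm_comp_le_of hU4 n5Z)).trans (le_of_eq (by ring))
    · refine (norm_comp_le_of hZ4 hZ2).trans (le_of_eq (by ring))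
  · have hm : T₂ - ((S : H →L[ℂ] H).comp T₁).comp (S.symm : H →L[ℂ] H) ∈ Cpt H H := by
      rw [main]
      exact sub_mem (Cpt_comp_left (Cpt_comp_right hU3 _) _) (Cpt_comp_right hZ3 _)
    exact Cpt_isCompact hm

end final

end helpers

/-- The set of operators of the form `S T₁ S⁻¹` with `S` invertible and
`‖S‖ ‖S⁻¹‖ ≤ lam`. -/
def boundedSimOrbit {H : Type*} [NormedAddCommGroup H] [InnerProductSpace ℂ H]
    (T₁ : H →L[ℂ] H) (lam : ℝ) : Set (H →L[ℂ] H) :=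
  {A | ∃ S : H ≃L[ℂ] H, ‖(S : H →L[ℂ] H)‖ * ‖(S.symm : H →L[ℂ] H)‖ ≤ lam ∧
    A = ((S : H →L[ℂ] H).comp T₁).comp (S.symm : H →L[ℂ] H)}

/-- **Theorem 3.6.** If `T₂` is a norm limit of operators `S T₁ S⁻¹` with
`‖S‖ ‖S⁻¹‖ ≤ λ`, then the approximating similarities `Sₙ` can be chosen so that moreover each
difference `T₂ - Sₙ T₁ Sₙ⁻¹` is compact. -/
theorem stmt13 {H : Type*} [NormedAddCommGroup H] [InnerProductSpace ℂ H] [CompleteSpace H]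
    [TopologicalSpace.SeparableSpace H] (hinf : ¬ FiniteDimensional ℂ H)
    (T₁ T₂ : H →L[ℂ] H) (lam : ℝ) (hlam : 1 ≤ lam)
    (h : T₂ ∈ closure (boundedSimOrbit T₁ lam)) :
    ∃ S : ℕ → (H ≃L[ℂ] H),
      (∀ n, ‖((S n) : H →L[ℂ] H)‖ * ‖((S n).symm : H →L[ℂ] H)‖ ≤ lam) ∧
      Filter.Tendsto
        (fun n => ‖T₂ - (((S n : H →L[ℂ] H)).comp T₁).comp ((S n).symm : H →L[ℂ] H)‖)
        Filter.atTop (nhds 0) ∧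
      (∀ n, IsCompactOperator
        (T₂ - (((S n : H →L[ℂ] H)).comp T₁).comp ((S n).symm : H →L[ℂ] H))) := by
  have hnt : Nontrivial H := by
    by_contra hn
    rw [not_nontrivial_iff_subsingleton] at hn
    exact hinf inferInstance
  obtain ⟨P, Q, hP, hQ, hPQ, hQP, hlim⟩ := exists_seq T₁ T₂ lam h
  have key : ∀ n : ℕ, ∃ S : H ≃L[ℂ] H,
      ‖(S : H →L[ℂ] H)‖ * ‖(S.symm : H →L[ℂ] H)‖ ≤ lam ∧
      ‖T₂ - ((S : H →L[ℂ] H).comp T₁).comp (S.symm : H →L[ℂ] H)‖ ≤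
        lam * (1 / ((n : ℝ) + 1)) + 1 / ((n : ℝ) + 1) ∧
      IsCompactOperator (T₂ - ((S : H →L[ℂ] H).comp T₁).comp (S.symm : H →L[ℂ] H)) :=
    fun n => final_step T₁ T₂ lam hlam P Q hP hQ hPQ hQP hlim _ (by positivity)
  choose S h1 h2 h3 using key
  refine ⟨S, h1, squeeze_zero (fun n => norm_nonneg _) h2 ?_, h3⟩
  have h4 := tendsto_one_div_add_atTop_nhds_zero_nat (𝕜 := ℝ)
  have h5 := (h4.const_mul lam).add h4
  simpa using h5
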